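/- For every R₁ > 0 there exists C' ≥ 1 such that: if x, y ∈ Γ, α ∈ [x,y] is a geodesic segment and v ∈ N(α,R₁), then G_Δ(x,y) ≤ C' · F_Δ(x,v) · G_Δ(v,y) for every subset Δ ⊂ Γ containing N(α, R₀ + R₁), where R₀ is the constant from the almost-multiplicativity proposition. -/

import Mathlib

open Filter Topology MeasureTheory
open scoped ENNReal

namespace HarmonicBoundary

variable {Γ : Type} [Group Γ]

/-- Word length of `g` with respect to a generating set `S`. -/
noncomputable def wl (S : Set Γ) (g : Γ) : ℕ :=
  sInf {n : ℕ | ∃ w : List Γ, w.length = n ∧ (∀ x ∈ w, x ∈ S) ∧ w.prod = g}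

/-- Word metric `d(x,y) = |x⁻¹y|`. -/
noncomputable def wdist (S : Set Γ) (x y : Γ) : ℕ := wl S (x⁻¹ * y)

/-- Gromov product `(x|y)_z = (d(x,z)+d(y,z)-d(x,y))/2`. -/
noncomputable def gp (S : Set Γ) (z x y : Γ) : ℝ :=
  ((wdist S x z : ℝ) + (wdist S y z : ℝ) - (wdist S x y : ℝ)) / 2

/-- `S` is a finite symmetric generating set of `Γ`. -/
def IsGenSet (S : Set Γ) : Prop :=
  S.Finite ∧ (∀ s ∈ S, s⁻¹ ∈ S) ∧ Subgroup.closure S = ⊤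

/-- `Γ` is `δ`-hyperbolic with respect to the word metric of `S`:
`(x|y) ≥ min ((x|z), (y|z)) - δ` for all `x y z`. -/
def IsHyperbolic (S : Set Γ) (δ : ℝ) : Prop :=
  0 ≤ δ ∧ ∀ x y z : Γ, min (gp S 1 x z) (gp S 1 y z) - δ ≤ gp S 1 x y

/-- `Γ` is nonelementary: it has no cyclic subgroup of finite index. -/
def Nonelementary (Γ : Type) [Group Γ] : Prop :=
  ∀ g : Γ, (Subgroup.zpowers g).index = 0

/-- A sequence converges to infinity if `(x_i|x_j) → ∞`. -/
def ConvInf (S : Set Γ) (u : ℕ → Γ) : Prop :=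
  Tendsto (fun p : ℕ × ℕ => gp S 1 (u p.1) (u p.2)) atTop atTop

/-- Two sequences converging to infinity are equivalent if `(x_i|y_j) → ∞`. -/
def EquivSeq (S : Set Γ) (u v : ℕ → Γ) : Prop :=
  Tendsto (fun p : ℕ × ℕ => gp S 1 (u p.1) (v p.2)) atTop atTop

/-- An (abstract model of the) Gromov boundary of `Γ`: the points are exactly the
classes of sequences converging to infinity, modulo the equivalence `EquivSeq`,
together with the natural left action of `Γ`. -/
structure Boundary (Γ : Type) [Group Γ] (S : Set Γ) where
  pt : Type
  cls : (ℕ → Γ) → pt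
  cls_surj : ∀ ξ : pt, ∃ u : ℕ → Γ, ConvInf S u ∧ cls u = ξ
  cls_eq : ∀ u v : ℕ → Γ, ConvInf S u → ConvInf S v → (cls u = cls v ↔ EquivSeq S u v)
  smul : Γ → pt → pt
  smul_cls : ∀ (g : Γ) (u : ℕ → Γ), ConvInf S u → smul g (cls u) = cls fun n => g * u n

/-- Extension of the Gromov product to the boundary:
`(ξ|η) = sup liminf (x_i|y_j)` over sequences representing `ξ` and `η`,
as an extended nonnegative real. -/
noncomputable def bgp {S : Set Γ} (B : Boundary Γ S) (ξ η : B.pt) : ℝ≥0∞ :=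
  ⨆ (u : {u : ℕ → Γ // ConvInf S u ∧ B.cls u = ξ})
    (v : {v : ℕ → Γ // ConvInf S v ∧ B.cls v = η}),
    Filter.liminf (fun p : ℕ × ℕ => ENNReal.ofReal (gp S 1 (u.1 p.1) (v.1 p.2))) atTop

/-- Real-valued Gromov product on the boundary (finite for `ξ ≠ η`). -/
noncomputable def bgpR {S : Set Γ} (B : Boundary Γ S) (ξ η : B.pt) : ℝ := (bgp B ξ η).toReal

/-- The canonical topology of the Gromov boundary: a set is open iff around each of
its points it contains a basic neighbourhood `V_r(p) = {q | (q|p) > r}`. -/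
def btop {S : Set Γ} (B : Boundary Γ S) : TopologicalSpace B.pt where
  IsOpen O := ∀ p ∈ O, ∃ r : ℝ≥0∞, r ≠ ⊤ ∧ {q | r < bgp B q p} ⊆ O
  isOpen_univ := fun p _ => ⟨0, ENNReal.zero_ne_top, fun q _ => trivial⟩
  isOpen_inter := by
    intro A A' hA hA' p hp
    obtain ⟨r1, hr1, h1⟩ := hA p hp.1
    obtain ⟨r2, hr2, h2⟩ := hA' p hp.2
    refine ⟨max r1 r2, (max_lt hr1.lt_top hr2.lt_top).ne, fun q hq => ?_⟩
    have hq' : max r1 r2 < bgp B q p := hq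
    exact ⟨h1 (show r1 < bgp B q p from (le_max_left r1 r2).trans_lt hq'),
      h2 (show r2 < bgp B q p from (le_max_right r1 r2).trans_lt hq')⟩
  isOpen_sUnion := by
    intro s hs p hp
    obtain ⟨t, ht, hpt⟩ := hp
    obtain ⟨r, hr, hsub⟩ := hs t ht p hpt
    exact ⟨r, hr, fun q hq => ⟨t, ht, hsub hq⟩⟩

/-- The attracting fixed point `g⁺ = lim_n gⁿ` of an (infinite order) element. -/
def plusPt {S : Set Γ} (B : Boundary Γ S) (g : Γ) : B.pt := B.cls fun n => g ^ n

/-- The repelling fixed point `g⁻ = lim_n g⁻ⁿ` of an (infinite order) element. -/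
def minusPt {S : Set Γ} (B : Boundary Γ S) (g : Γ) : B.pt := B.cls fun n => g⁻¹ ^ n

/-- A geodesic ray starting at the identity. -/
def IsGeodesicRay (S : Set Γ) (x : ℕ → Γ) : Prop :=
  x 0 = 1 ∧ ∀ m n : ℕ, wdist S (x m) (x n) = Nat.dist m n

/-- A geodesic ray from `e` to the boundary point `ξ`, i.e. an element of `[e,ξ]`. -/
def RayTo {S : Set Γ} (B : Boundary Γ S) (x : ℕ → Γ) (ξ : B.pt) : Prop :=
  IsGeodesicRay S x ∧ ConvInf S x ∧ B.cls x = ξ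

/-- A geodesic segment from `x` to `y` (parametrized on `0,…,d(x,y)`),
i.e. an element of `[x,y]`. -/
def IsGeodesicSeg (S : Set Γ) (x y : Γ) (α : ℕ → Γ) : Prop :=
  α 0 = x ∧ α (wdist S x y) = y ∧
  ∀ m n : ℕ, m ≤ wdist S x y → n ≤ wdist S x y → wdist S (α m) (α n) = Nat.dist m n

/-- The boundary "cylinder" `U(ξ,R)`: all `η` such that for every pair of geodesic
rays `x ∈ [e,ξ]`, `y ∈ [e,η]` one has `lim_n (x(n)|y(n)) > R` (the sequence
`(x(n)|y(n))` is nondecreasing, so the limit exceeds `R` iff some term does). -/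
def Uset {S : Set Γ} (B : Boundary Γ S) (ξ : B.pt) (R : ℝ) : Set B.pt :=
  {η | ∀ x y : ℕ → Γ, RayTo B x ξ → RayTo B y η → ∃ n : ℕ, R < gp S 1 (x n) (y n)}

/-- `C_r(p) = {g | (g|e)_p > r}`. -/
def Cset (S : Set Γ) (p : Γ) (r : ℝ) : Set Γ := {g | r < gp S p g 1}

/-- The `R`-neighbourhood `N(α,R)` of a geodesic segment `α ∈ [x,y]`. -/
def segN (S : Set Γ) (x y : Γ) (α : ℕ → Γ) (R : ℝ) : Set Γ :=
  {g | ∃ i ≤ wdist S x y, (wdist S g (α i) : ℝ) ≤ R}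

/-- The `R`-neighbourhood `N(A,R)` of a subset `A ⊆ Γ`. -/
def setN (S : Set Γ) (A : Set Γ) (R : ℝ) : Set Γ :=
  {g | ∃ a ∈ A, (wdist S g a : ℝ) ≤ R}

/-- `μ` is a nondegenerate probability measure on `Γ` with support contained in `S`:
nonnegative, of total mass one, supported in `S`, and the semigroup generated by its
support is the whole of `Γ`. -/
structure IsRWMeasure (S : Set Γ) (μ : Γ → ℝ) : Prop where
  nonneg : ∀ g, 0 ≤ μ g
  support_subset : ∀ g, μ g ≠ 0 → g ∈ S
  total : ∑' g : Γ, μ g = 1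
  nondeg : ∀ g : Γ, ∃ l : List Γ, l ≠ [] ∧ (∀ x ∈ l, 0 < μ x) ∧ l.prod = g

open Classical in
/-- `n`-step transition probabilities `p⁽ⁿ⁾(x,y) = μ*ⁿ(x⁻¹y)` of the random walk. -/
noncomputable def ptrans (μ : Γ → ℝ) : ℕ → Γ → Γ → ℝ
  | 0 => fun x y => if x = y then 1 else 0
  | n + 1 => fun x y => ∑' z : Γ, ptrans μ n x z * μ (z⁻¹ * y)

/-- Green function `G(x,y) = Σ_n p⁽ⁿ⁾(x,y)`. -/
noncomputable def green (μ : Γ → ℝ) (x y : Γ) : ℝ := ∑' n : ℕ, ptrans μ n x y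

/-- `F(x,y) = G(x,y)/G(y,y)`, the probability that the walk from `x` ever hits `y`. -/
noncomputable def greenF (μ : Γ → ℝ) (x y : Γ) : ℝ := green μ x y / green μ y y

/-- The Martin kernel `K(x,y) = G(x,y)/G(e,y)`. -/
noncomputable def martinK (μ : Γ → ℝ) (x y : Γ) : ℝ := green μ x y / green μ 1 y

open Classical in
/-- Transition probabilities of the walk restricted to `Δ` (killed when leaving `Δ`). -/
noncomputable def ptransR (μ : Γ → ℝ) (Δ : Set Γ) : ℕ → Γ → Γ → ℝ
  | 0 => fun x y => if x = y ∧ x ∈ Δ then 1 else 0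
  | n + 1 => fun x y => if y ∈ Δ then ∑' z : Γ, ptransR μ Δ n x z * μ (z⁻¹ * y) else 0

/-- Green function `G_Δ` of the restricted walk. -/
noncomputable def greenR (μ : Γ → ℝ) (Δ : Set Γ) (x y : Γ) : ℝ := ∑' n : ℕ, ptransR μ Δ n x y

/-- `F_Δ(x,y) = G_Δ(x,y)/G_Δ(y,y)`. -/
noncomputable def greenFR (μ : Γ → ℝ) (Δ : Set Γ) (x y : Γ) : ℝ :=
  greenR μ Δ x y / greenR μ Δ y y

/-- Generating function `G_Δ(x,y|z) = Σ_n p_Δ⁽ⁿ⁾(x,y) zⁿ`. -/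
noncomputable def greenRZ (μ : Γ → ℝ) (Δ : Set Γ) (x y : Γ) (z : ℝ) : ℝ :=
  ∑' n : ℕ, ptransR μ Δ n x y * z ^ n

/-- Spectral radius `ρ(P) = lim_n p⁽ⁿ⁾(e,e)^{1/n}` of the walk. -/
noncomputable def specRad (μ : Γ → ℝ) : ℝ :=
  Filter.limsup (fun n : ℕ => (ptrans μ n 1 1) ^ ((n : ℝ)⁻¹)) atTop

/-- `u` is harmonic on `Λ`: `Σ_h p(g,h) u(h) = u(g)` for `g ∈ Λ`, `p(g,h)=μ(g⁻¹h)`. -/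
def HarmonicOn (μ : Γ → ℝ) (u : Γ → ℝ) (Λ : Set Γ) : Prop :=
  ∀ g ∈ Λ, (∑' h : Γ, μ (g⁻¹ * h) * u h) = u g

/-- `u` vanishes at infinity on `Λ`: `u(g_n) → 0` along sequences in `Λ` with `|g_n|→∞`. -/
def VanishesAtInftyOn (S : Set Γ) (u : Γ → ℝ) (Λ : Set Γ) : Prop :=
  ∀ ε : ℝ, 0 < ε → ∃ M : ℕ, ∀ g ∈ Λ, M ≤ wl S g → |u g| ≤ ε

open Classical in
/-- `r(g) = K(g⁻¹,g⁺)` for infinite order `g`, and `r(g) = 1` for finite order `g`;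
here `Kb` is the boundary extension of the Martin kernel. -/
noncomputable def rfun {S : Set Γ} (B : Boundary Γ S) (Kb : Γ → B.pt → ℝ) (g : Γ) : ℝ :=
  if IsOfFinOrder g then 1 else Kb g⁻¹ (plusPt B g)

/-- The ratio set `r(Γ,∂Γ,ν)`: all `l ≥ 0` such that for every `ε > 0` and every
Borel `A` of positive measure there is `g ∈ Γ` such that
`{ω ∈ gA ∩ A : |d(gν)/dν(ω) − l| < ε}` has positive measure; here the
Radon–Nikodym derivative `d(gν)/dν` is the Martin kernel `Kb g`. -/
def ratioSet {S : Set Γ} (B : Boundary Γ S) [MeasurableSpace B.pt]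
    (ν : Measure B.pt) (Kb : Γ → B.pt → ℝ) : Set ℝ :=
  {l : ℝ | 0 ≤ l ∧ ∀ ε : ℝ, 0 < ε → ∀ A : Set B.pt, MeasurableSet A → 0 < ν A →
    ∃ g : Γ, 0 < ν {ω | ω ∈ A ∧ B.smul g⁻¹ ω ∈ A ∧ |Kb g ω - l| < ε}}

/-- A left invariant finitely additive mean on `Γ`; `Γ` is amenable iff one exists. -/
structure InvariantMean (Γ : Type) [Group Γ] where
  m : Set Γ → ℝ
  nonneg : ∀ A, 0 ≤ m A
  total : m Set.univ = 1
  fin_add : ∀ A B : Set Γ, Disjoint A B → m (A ∪ B) = m A + m B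
  invariant : ∀ (g : Γ) (A : Set Γ), m ((g * ·) ⁻¹' A) = m A

theorem wl_exists {S : Set Γ} (hS : IsGenSet S) (g : Γ) :
    ∃ w : List Γ, w.length = wl S g ∧ (∀ x ∈ w, x ∈ S) ∧ w.prod = g := by
  have hne : {n : ℕ | ∃ w : List Γ, w.length = n ∧ (∀ x ∈ w, x ∈ S) ∧ w.prod = g}.Nonempty := by
    have hg : g ∈ Subgroup.closure S := by rw [hS.2.2]; trivial
    have hg' : g ∈ Submonoid.closure (S ∪ S⁻¹) := by
      rw [← Subgroup.closure_toSubmonoid]; exact hg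
    obtain ⟨l, hl, hp⟩ := Submonoid.exists_list_of_mem_closure hg'
    refine ⟨l.length, l, rfl, fun x hx => ?_, hp⟩
    rcases hl x hx with h | h
    · exact h
    · have := hS.2.1 _ h
      simpa using this
  exact Nat.sInf_mem hne

theorem wl_le {S : Set Γ} (w : List Γ) (hw : ∀ x ∈ w, x ∈ S) : wl S w.prod ≤ w.length :=
  Nat.sInf_le ⟨w, rfl, hw, rfl⟩

theorem wl_one (S : Set Γ) : wl S (1 : Γ) = 0 := by
  have := wl_le (S := S) ([] : List Γ) (by simp)
  simpa using this

theorem wl_mul_le {S : Set Γ} (hS : IsGenSet S) (g h : Γ) : wl S (g * h) ≤ wl S g + wl S h := by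
  obtain ⟨w, hw, hw', rfl⟩ := wl_exists hS g
  obtain ⟨v, hv, hv', rfl⟩ := wl_exists hS h
  rw [← hw, ← hv, ← List.prod_append, ← List.length_append]
  apply wl_le
  intro x hx
  rcases List.mem_append.1 hx with h | h
  · exact hw' x h
  · exact hv' x h

theorem wl_inv_le {S : Set Γ} (hS : IsGenSet S) (g : Γ) : wl S g⁻¹ ≤ wl S g := by
  obtain ⟨w, hw, hw', rfl⟩ := wl_exists hS g
  rw [← hw, List.prod_inv_reverse]
  refine (wl_le _ ?_).trans (by simp)
  intro x hx
  simp only [List.mem_reverse, List.mem_map] at hx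
  obtain ⟨a, ha, rfl⟩ := hx
  exact hS.2.1 _ (hw' a ha)

theorem wl_inv {S : Set Γ} (hS : IsGenSet S) (g : Γ) : wl S g⁻¹ = wl S g :=
  le_antisymm (wl_inv_le hS g) (by simpa using wl_inv_le hS g⁻¹)

theorem wl_prefix {S : Set Γ} (hS : IsGenSet S) (g : Γ) (k : ℕ) (hk : k ≤ wl S g) :
    ∃ p : Γ, wl S p = k ∧ wl S (p⁻¹ * g) + k = wl S g := by
  obtain ⟨w, hw, hw', hg⟩ := wl_exists hS g
  have h1 : wl S (w.take k).prod ≤ k := by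
    refine (wl_le _ fun x hx => hw' x (List.mem_of_mem_take hx)).trans (by simp)
  have h2 : wl S (w.drop k).prod ≤ wl S g - k := by
    refine (wl_le _ fun x hx => hw' x (List.mem_of_mem_drop hx)).trans (by simp [hw])
  have h3 : (w.take k).prod * (w.drop k).prod = g := by
    rw [List.prod_take_mul_prod_drop, hg]
  have h4 := wl_mul_le hS (w.take k).prod (w.drop k).prod
  rw [h3] at h4
  refine ⟨(w.take k).prod, by omega, ?_⟩
  have : (w.take k).prod⁻¹ * g = (w.drop k).prod := by rw [← h3]; group
  rw [this]; omega

theorem eq_one_of_wl {S : Set Γ} (hS : IsGenSet S) {g : Γ} (h : wl S g = 0) : g = 1 := by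
  obtain ⟨w, hw, hw', hg⟩ := wl_exists hS g
  rw [h] at hw
  rw [List.length_eq_zero_iff.1 hw] at hg
  simpa using hg.symm

theorem mem_of_wl_one {S : Set Γ} (hS : IsGenSet S) {g : Γ} (h : wl S g = 1) : g ∈ S := by
  obtain ⟨w, hw, hw', hg⟩ := wl_exists hS g
  rw [h] at hw
  obtain ⟨a, rfl⟩ := List.length_eq_one_iff.1 hw
  simp at hg hw'
  rwa [← hg]

theorem wl_gen {S : Set Γ} {s : Γ} (h : s ∈ S) : wl S s ≤ 1 := by
  have := wl_le (S := S) [s] (by simpa using h)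
  simpa using this

/-- split off the last letter -/
theorem wl_last {S : Set Γ} (hS : IsGenSet S) (g : Γ) (n : ℕ) (h : wl S g = n + 1) :
    ∃ p s : Γ, wl S p = n ∧ s ∈ S ∧ g = p * s := by
  obtain ⟨p, hp, hp'⟩ := wl_prefix hS g n (by omega)
  refine ⟨p, p⁻¹ * g, hp, mem_of_wl_one hS (by omega), by group⟩

theorem ball_finite {S : Set Γ} (hS : IsGenSet S) (n : ℕ) : {g : Γ | wl S g ≤ n}.Finite := by
  induction n with
  | zero =>
    refine (Set.finite_singleton (1 : Γ)).subset ?_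
    intro g hg
    exact eq_one_of_wl hS (Nat.le_zero.1 hg)
  | succ n ih =>
    refine (ih.union (Set.Finite.image2 (fun a b => a * b) ih hS.1)).subset ?_
    intro g hg
    have hg : wl S g ≤ n + 1 := hg
    rcases Nat.lt_or_ge (wl S g) (n + 1) with h | h
    · left; show wl S g ≤ n; omega
    · right
      obtain ⟨p, s, hp, hs, rfl⟩ := wl_last hS g n (by omega)
      exact ⟨p, hp.le, s, hs, rfl⟩

theorem wdist_self (S : Set Γ) (x : Γ) : wdist S x x = 0 := by simp [wdist, wl_one]

theorem wdist_comm {S : Set Γ} (hS : IsGenSet S) (x y : Γ) : wdist S x y = wdist S y x := by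
  unfold wdist
  rw [← wl_inv hS]; congr 1; group

theorem wdist_tri {S : Set Γ} (hS : IsGenSet S) (x y z : Γ) :
    wdist S x z ≤ wdist S x y + wdist S y z := by
  unfold wdist
  have := wl_mul_le hS (x⁻¹ * y) (y⁻¹ * z)
  rwa [show x⁻¹ * y * (y⁻¹ * z) = x⁻¹ * z by group] at this

theorem wdist_left (S : Set Γ) (g x y : Γ) : wdist S (g * x) (g * y) = wdist S x y := by
  unfold wdist; congr 1; group

theorem wdist_mul (S : Set Γ) (x y : Γ) : wdist S x (x * y) = wl S y := by
  unfold wdist; congr 1; group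

theorem wdist_one_left (S : Set Γ) (y : Γ) : wdist S 1 y = wl S y := by
  unfold wdist; congr 1; group

theorem wdist_one_right {S : Set Γ} (hS : IsGenSet S) (y : Γ) : wdist S y 1 = wl S y := by
  rw [wdist_comm hS, wdist_one_left]

theorem gp_comm {S : Set Γ} (hS : IsGenSet S) (z x y : Γ) : gp S z x y = gp S z y x := by
  unfold gp; rw [wdist_comm hS x y]; ring

theorem gp_left (S : Set Γ) (g z x y : Γ) : gp S (g * z) (g * x) (g * y) = gp S z x y := by
  unfold gp; simp only [wdist_left]

theorem hyp_base {S : Set Γ} {δ : ℝ} (hδ : IsHyperbolic S δ) (o x y z : Γ) :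
    min (gp S o x z) (gp S o y z) - δ ≤ gp S o x y := by
  have := hδ.2 (o⁻¹ * x) (o⁻¹ * y) (o⁻¹ * z)
  rw [← gp_left S o, ← gp_left S o 1 (o⁻¹ * y), ← gp_left S o 1 (o⁻¹ * x)] at this
  simpa using this

/-- Gromov product at the identity, in terms of lengths. -/
theorem gp_one {S : Set Γ} (hS : IsGenSet S) (x y : Γ) :
    gp S 1 x y = ((wl S x : ℝ) + wl S y - wl S (x⁻¹ * y)) / 2 := by
  unfold gp; rw [wdist_one_right hS, wdist_one_right hS]; rfl

theorem gp_le_left {S : Set Γ} (hS : IsGenSet S) (x y : Γ) : gp S 1 x y ≤ wl S x := by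
  rw [gp_one hS]
  have : wl S y ≤ wl S x + wl S (x⁻¹ * y) := by
    have := wl_mul_le hS x (x⁻¹ * y)
    rwa [show x * (x⁻¹ * y) = y by group] at this
  have : (wl S y : ℝ) ≤ wl S x + wl S (x⁻¹ * y) := by exact_mod_cast this
  linarith

theorem gp_nonneg {S : Set Γ} (hS : IsGenSet S) (x y : Γ) : 0 ≤ gp S 1 x y := by
  rw [gp_one hS]
  have := wl_mul_le hS x⁻¹ y
  rw [wl_inv hS] at this
  have : (wl S (x⁻¹ * y) : ℝ) ≤ wl S x + wl S y := by exact_mod_cast this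
  linarith

theorem wl_mul_eq {S : Set Γ} (hS : IsGenSet S) (x y : Γ) :
    (wl S (x * y) : ℝ) = wl S x + wl S y - 2 * gp S 1 x⁻¹ y := by
  rw [gp_one hS, wl_inv hS, inv_inv]; ring

/-- the Gromov product decreases when passing to prefixes -/
theorem gp_prefix {S : Set Γ} (hS : IsGenSet S) (x y p : Γ)
    (h : wl S (p⁻¹ * x) + wl S p = wl S x) : gp S 1 p y ≤ gp S 1 x y := by
  rw [gp_one hS, gp_one hS]
  have h1 := wdist_tri hS x p y
  have h2 : wdist S x p = wl S (p⁻¹ * x) := by rw [wdist_comm hS]; rfl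
  rw [h2] at h1
  have h1 : (wl S (x⁻¹ * y) : ℝ) ≤ wl S (p⁻¹ * x) + wl S (p⁻¹ * y) := by exact_mod_cast h1
  have h : (wl S (p⁻¹ * x) + wl S p : ℝ) = wl S x := by exact_mod_cast h
  linarith

theorem hyp_or {S : Set Γ} {δ : ℝ} (hδ : IsHyperbolic S δ) (x y z : Γ) :
    gp S 1 x z ≤ gp S 1 x y + δ ∨ gp S 1 y z ≤ gp S 1 x y + δ := by
  have := hδ.2 x y z
  rcases min_choice (gp S 1 x z) (gp S 1 y z) with h | h <;> rw [h] at this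
  · left; linarith
  · right; linarith

theorem infinite_of_nonel (hne : Nonelementary Γ) : Infinite Γ := by
  have h := hne 1
  rw [Subgroup.zpowers_one_eq_bot, Subgroup.index_bot] at h
  rcases Nat.card_eq_zero.1 h with h | h
  · exact (h.false (1 : Γ)).elim
  · exact h

theorem exists_wl {S : Set Γ} (hS : IsGenSet S) (hinf : Infinite Γ) (n : ℕ) :
    ∃ g : Γ, wl S g = n := by
  have : ∃ g : Γ, n < wl S g := by
    by_contra hcon
    push Not at hcon
    exact Set.infinite_univ ((ball_finite hS n).subset fun g _ => hcon g)
  obtain ⟨g, hg⟩ := this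
  obtain ⟨p, hp, -⟩ := wl_prefix hS g n hg.le
  exact ⟨p, hp⟩

theorem exists_lox {S : Set Γ} {δ : ℝ} (hS : IsGenSet S) (hδ : IsHyperbolic S δ)
    (hinf : Infinite Γ) (M : ℝ) :
    ∃ f : Γ, M ≤ wl S f ∧ gp S 1 f f⁻¹ ≤ 3 * δ + 1 := by
  have hδ0 := hδ.1
  obtain ⟨n, hn⟩ := exists_nat_ge (max M 0 + 10 * δ + 10)
  have hM : M ≤ max M 0 := le_max_left _ _
  have hM0 : 0 ≤ max M 0 := le_max_right _ _
  obtain ⟨w, hw⟩ := exists_wl hS hinf (2 * n)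
  obtain ⟨u, hu, hu'⟩ := wl_prefix hS w n (by omega)
  obtain ⟨p, hp⟩ : ∃ p, p = u⁻¹ := ⟨_, rfl⟩
  obtain ⟨q, hq⟩ : ∃ q, q = u⁻¹ * w := ⟨_, rfl⟩
  have hpn : wl S p = n := by rw [hp, wl_inv hS, hu]
  have hqn : wl S q = n := by rw [hq]; omega
  have hpq : gp S 1 p q = 0 := by
    rw [gp_one hS, hpn, hqn, show p⁻¹ * q = w by rw [hp, hq]; group, hw]
    push_cast; ring
  by_cases h1 : gp S 1 p p⁻¹ ≤ 3 * δ + 1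
  · exact ⟨p, by rw [hpn]; linarith, h1⟩
  by_cases h2 : gp S 1 q q⁻¹ ≤ 3 * δ + 1
  · exact ⟨q, by rw [hqn]; linarith, h2⟩
  push Not at h1 h2
  have h3 : gp S 1 p q⁻¹ ≤ δ := by
    rcases hyp_or hδ p q q⁻¹ with h | h <;> linarith
  have h4 : gp S 1 p⁻¹ q⁻¹ ≤ 2 * δ := by
    rcases hyp_or hδ q⁻¹ p p⁻¹ with h | h
    · rw [gp_comm hS 1 q⁻¹ p, gp_comm hS 1 q⁻¹ p⁻¹] at h
      linarith
    · rw [gp_comm hS 1 q⁻¹ p] at h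
      linarith
  have hf : (wl S (p * q⁻¹) : ℝ) = 2 * n - 2 * gp S 1 p⁻¹ q⁻¹ := by
    rw [wl_mul_eq hS, wl_inv hS, hpn, hqn]; ring
  have hfp : gp S 1 p (p * q⁻¹) = wl S (p * q⁻¹) / 2 := by
    rw [gp_one hS, show p⁻¹ * (p * q⁻¹) = q⁻¹ by group, wl_inv hS, hpn, hqn]; ring
  have hfi : (p * q⁻¹)⁻¹ = q * p⁻¹ := by group
  have hfq : gp S 1 q (p * q⁻¹)⁻¹ = wl S (p * q⁻¹) / 2 := by
    rw [gp_one hS, wl_inv hS, hfi, show q⁻¹ * (q * p⁻¹) = p⁻¹ by group, wl_inv hS, hpn, hqn]; ring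
  refine ⟨p * q⁻¹, by linarith, ?_⟩
  have h5 : gp S 1 p (p * q⁻¹)⁻¹ ≤ δ := by
    rcases hyp_or hδ p q (p * q⁻¹)⁻¹ with h | h <;> linarith
  rcases hyp_or hδ p (p * q⁻¹)⁻¹ (p * q⁻¹) with h | h
  · linarith
  · rw [gp_comm hS] at h; linarith

/-- Estimates on powers of a loxodromic element. -/
theorem lox_powers {S : Set Γ} {δ : ℝ} (hS : IsGenSet S) (hδ : IsHyperbolic S δ) (f : Γ) (K : ℝ)
    (hK : 0 ≤ K) (hf : gp S 1 f f⁻¹ ≤ K) (hl : 4 * (K + 3 * δ) + 4 ≤ wl S f) (k : ℕ) :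
    gp S 1 f⁻¹ (f ^ (k + 1)) ≤ K + δ ∧ (wl S (f ^ k) : ℝ) + 1 ≤ wl S (f ^ (k + 1)) ∧
      wl S f - (K + δ) ≤ gp S 1 f (f ^ (k + 1)) ∧
      wl S f - (K + δ) ≤ gp S 1 f⁻¹ ((f ^ (k + 1))⁻¹) := by
  have hδ0 := hδ.1
  have e1 : ∀ k : ℕ, (wl S (f ^ (k + 1)) : ℝ) = wl S f + wl S (f ^ k) - 2 * gp S 1 f⁻¹ (f ^ k) := by
    intro k; rw [pow_succ', wl_mul_eq hS]
  have e2 : ∀ k : ℕ, gp S 1 f (f ^ (k + 1)) = (wl S f + wl S (f ^ (k + 1)) - wl S (f ^ k)) / 2 := by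
    intro k; rw [gp_one hS]; congr 3; rw [pow_succ']; group
  have e3 : ∀ k : ℕ, gp S 1 f⁻¹ ((f ^ (k + 1))⁻¹) = gp S 1 f (f ^ (k + 1)) := by
    intro k
    rw [e2, gp_one hS, wl_inv hS, wl_inv hS, ← wl_inv hS (f ^ k)]; congr 4; rw [pow_succ]; group
  have P : ∀ k, gp S 1 f⁻¹ (f ^ k) ≤ K + δ := by
    intro k
    induction k with
    | zero =>
      rw [pow_zero, gp_one hS, wl_one, mul_one, inv_inv, wl_inv hS]; simp; linarith
    | succ k ih =>
      have h1 := e1 k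
      have h2 := e2 k
      rcases hyp_or hδ f f⁻¹ (f ^ (k + 1)) with h | h <;> linarith
  refine ⟨P _, ?_, ?_, ?_⟩
  · have := e1 k; have := P k; linarith
  · have := e1 k; have := P k; have := e2 k; linarith
  · have := e1 k; have := P k; have := e2 k; rw [e3]; linarith

theorem exists_triples {S : Set Γ} {δ : ℝ} (hS : IsGenSet S) (hδ : IsHyperbolic S δ)
    (hne : Nonelementary Γ) :
    ∃ C : ℝ, 0 ≤ C ∧ ∀ N : ℕ, ∃ x : Fin 3 → Γ, (∀ i, wl S (x i) = N) ∧
      ∀ i j, i ≠ j → gp S 1 (x i) (x j) ≤ C := by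
  have hδ0 := hδ.1
  obtain ⟨f, hfl, hf⟩ := exists_lox hS hδ (infinite_of_nonel hne) (4 * ((3 * δ + 1) + 3 * δ) + 4)
  obtain ⟨K, hKdef⟩ : ∃ K : ℝ, K = 3 * δ + 1 := ⟨_, rfl⟩
  rw [← hKdef] at hf hfl
  have hK : 0 ≤ K := by rw [hKdef]; linarith
  have hp := lox_powers hS hδ f K hK hf hfl
  refine ⟨max (wl S f / 2 + δ) (K + 2 * δ), le_max_of_le_right (by linarith), fun N => ?_⟩
  have hgrow : ∀ k : ℕ, k ≤ wl S (f ^ k) := by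
    intro k
    induction k with
    | zero => simp
    | succ k ih =>
      have h := (hp k).2.1
      have h : wl S (f ^ k) + 1 ≤ wl S (f ^ (k + 1)) := by exact_mod_cast h
      omega
  -- a point far from the axis
  have hfar : ∃ g : Γ, ∀ n : ℤ, N < wl S (f ^ n * g) := by
    by_contra hcon
    push Not at hcon
    have hfin : Finite (Γ ⧸ Subgroup.zpowers f) := by
      have := (ball_finite hS N).to_subtype
      refine Finite.of_surjective
        (fun b : {g : Γ | wl S g ≤ N} => ((b.1⁻¹ : Γ) : Γ ⧸ Subgroup.zpowers f)) ?_
      intro c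
      induction c using QuotientGroup.induction_on with
      | H g =>
        obtain ⟨n, hn⟩ := hcon g⁻¹
        refine ⟨⟨f ^ n * g⁻¹, hn⟩, ?_⟩
        simp only
        rw [QuotientGroup.eq]
        refine ⟨n, ?_⟩
        simp
    exact (Subgroup.index_ne_zero_of_finite (H := Subgroup.zpowers f)) (hne f)
  obtain ⟨g0, hg0⟩ := hfar
  -- choose the nearest point
  obtain ⟨n0, hn0⟩ : ∃ n0 : ℤ, ∀ n : ℤ, wl S (f ^ n0 * g0) ≤ wl S (f ^ n * g0) := by
    have := WellFounded.has_min (measure fun n : ℤ => wl S (f ^ n * g0)).wf Set.univ ⟨0, trivial⟩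
    obtain ⟨n0, -, h⟩ := this
    exact ⟨n0, fun n => not_lt.1 (h n trivial)⟩
  obtain ⟨g, hg⟩ : ∃ g, g = f ^ n0 * g0 := ⟨_, rfl⟩
  have hgN : N < wl S g := hg ▸ hg0 n0
  have hgmin : ∀ n : ℤ, wl S g ≤ wl S (f ^ n * g) := by
    intro n
    have := hn0 (n + n0)
    rwa [zpow_add, mul_assoc, ← hg] at this
  have hgf : gp S 1 f g ≤ wl S f / 2 := by
    rw [gp_one hS]
    have := hgmin (-1)
    rw [zpow_neg_one] at this
    have : (wl S g : ℝ) ≤ wl S (f⁻¹ * g) := by exact_mod_cast this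
    linarith
  have hgf' : gp S 1 f⁻¹ g ≤ wl S f / 2 := by
    rw [gp_one hS, wl_inv hS]
    have := hgmin 1
    rw [zpow_one] at this
    have : (wl S g : ℝ) ≤ wl S (f⁻¹⁻¹ * g) := by rw [inv_inv]; exact_mod_cast this
    linarith
  obtain ⟨F, hF⟩ : ∃ F, F = f ^ (N + 1) := ⟨_, rfl⟩
  obtain ⟨q1, -, q3, q4⟩ := hp N
  rw [← hF] at q1 q3 q4
  have hFN : N < wl S F := by have := hgrow (N + 1); rw [← hF] at this; omega
  have a1 : gp S 1 g F ≤ wl S f / 2 + δ := by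
    rcases hyp_or hδ g f F with h | h
    · rw [gp_comm hS 1 g f] at h; linarith
    · rw [gp_comm hS 1 g f] at h; linarith
  have a2 : gp S 1 g F⁻¹ ≤ wl S f / 2 + δ := by
    rcases hyp_or hδ g f⁻¹ F⁻¹ with h | h
    · rw [gp_comm hS 1 g f⁻¹] at h; linarith
    · rw [gp_comm hS 1 g f⁻¹] at h; linarith
  have a3 : gp S 1 F F⁻¹ ≤ K + 2 * δ := by
    rcases hyp_or hδ F f⁻¹ F⁻¹ with h | h
    · rw [gp_comm hS 1 F f⁻¹] at h; linarith
    · rw [gp_comm hS 1 F f⁻¹] at h; linarith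
  obtain ⟨x0, hx0, hx0'⟩ := wl_prefix hS g N hgN.le
  obtain ⟨x1, hx1, hx1'⟩ := wl_prefix hS F N hFN.le
  obtain ⟨x2, hx2, hx2'⟩ := wl_prefix hS F⁻¹ N (by rw [wl_inv hS]; exact hFN.le)
  rw [← hx0] at hx0'
  rw [← hx1] at hx1'
  rw [← hx2] at hx2'
  have pre : ∀ a b x y : Γ, wl S (x⁻¹ * a) + wl S x = wl S a → wl S (y⁻¹ * b) + wl S y = wl S b →
      gp S 1 x y ≤ gp S 1 a b := by
    intro a b x y h1 h2
    refine (gp_prefix hS a y x h1).trans ?_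
    rw [gp_comm hS 1 a y, gp_comm hS 1 a b]
    exact gp_prefix hS b a y h2
  have b1 := (pre _ _ _ _ hx0' hx1').trans a1
  have b2 := (pre _ _ _ _ hx0' hx2').trans a2
  have b3 := (pre _ _ _ _ hx1' hx2').trans a3
  refine ⟨![x0, x1, x2], ?_, ?_⟩
  · intro i; fin_cases i <;> simp [hx0, hx1, hx2]
  · intro i j hij
    fin_cases i <;> fin_cases j <;> simp at hij ⊢
    · exact Or.inl b1
    · exact Or.inl b2
    · left; rw [gp_comm hS]; exact b1
    · exact Or.inr b3
    · left; rw [gp_comm hS]; exact b2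
    · right; rw [gp_comm hS]; exact b3

/-- The ball of radius `n` around the identity as a finset. -/
noncomputable def ballF {S : Set Γ} (hS : IsGenSet S) (n : ℕ) : Finset Γ :=
  (ball_finite hS n).toFinset

theorem mem_ballF {S : Set Γ} (hS : IsGenSet S) {n : ℕ} {g : Γ} :
    g ∈ ballF hS n ↔ wl S g ≤ n := by
  simp [ballF]

theorem one_mem_ballF {S : Set Γ} (hS : IsGenSet S) (n : ℕ) : (1 : Γ) ∈ ballF hS n := by
  rw [mem_ballF, wl_one]; exact Nat.zero_le _

theorem ballF_card_pos {S : Set Γ} (hS : IsGenSet S) (n : ℕ) : 0 < (ballF hS n).card :=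
  Finset.card_pos.2 ⟨1, one_mem_ballF hS n⟩

theorem ballF_card_add {S : Set Γ} (hS : IsGenSet S) (m n : ℕ) :
    (ballF hS (m + n)).card ≤ (ballF hS m).card * (ballF hS n).card := by
  classical
  rw [← Finset.card_product]
  refine (Finset.card_le_card (t := ((ballF hS m ×ˢ ballF hS n).image fun p => p.1 * p.2)) ?_).trans
    Finset.card_image_le
  intro g hg
  rw [mem_ballF] at hg
  obtain ⟨p, hp, hp'⟩ := wl_prefix hS g (min m (wl S g)) (min_le_right _ _)
  refine Finset.mem_image.2 ⟨(p, p⁻¹ * g), Finset.mem_product.2 ⟨?_, ?_⟩, by simp⟩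
  · rw [mem_ballF, hp]; exact min_le_left _ _
  · rw [mem_ballF]
    show wl S (p⁻¹ * g) ≤ n
    rcases min_choice m (wl S g) with h | h <;> rw [h] at hp' <;> omega

/-- Iterated sum operator. -/
def Tk (x : Fin 3 → Γ) : ℕ → (Γ → ℝ) → Γ → ℝ
  | 0, F => F
  | k + 1, F => fun g => ∑ i, Tk x k F (g * x i)

theorem Tk_const (x : Fin 3 → Γ) (k : ℕ) (g : Γ) : Tk x k (fun _ => 1) g = 3 ^ k := by
  induction k generalizing g with
  | zero => simp [Tk]
  | succ k ih => simp [Tk, ih, pow_succ]; ring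

theorem Tk_sum (x : Fin 3 → Γ) (B : Finset Γ) (F : Γ → Γ → ℝ) (k : ℕ) (g : Γ) :
    Tk x k (fun h => ∑ y ∈ B, F y h) g = ∑ y ∈ B, Tk x k (F y) g := by
  induction k generalizing g with
  | zero => simp [Tk]
  | succ k ih =>
    simp only [Tk, ih]
    exact Finset.sum_comm

theorem Tk_mono {S : Set Γ} (hS : IsGenSet S) (x : Fin 3 → Γ) (N : ℕ) (hx : ∀ i, wl S (x i) = N)
    (F F' : Γ → ℝ) (k : ℕ) (g : Γ) (h : ∀ w : Γ, wl S w ≤ k * N → F (g * w) ≤ F' (g * w)) :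
    Tk x k F g ≤ Tk x k F' g := by
  induction k generalizing g with
  | zero => simpa [wl_one, Tk] using h 1
  | succ k ih =>
    refine Finset.sum_le_sum fun i _ => ih _ fun w hw => ?_
    rw [mul_assoc]
    apply h
    have := wl_mul_le hS (x i) w
    rw [hx] at this
    linarith [add_mul k 1 N]

theorem Tk_eig (x : Fin 3 → Γ) (F : Γ → ℝ) (r : ℝ) (hr : 0 ≤ r)
    (hF : ∀ g, ∑ i, F (g * x i) ≤ r * F g) (k : ℕ) (g : Γ) : Tk x k F g ≤ r ^ k * F g := by
  induction k generalizing g with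
  | zero => simp [Tk]
  | succ k ih =>
    calc Tk x (k + 1) F g = ∑ i, Tk x k F (g * x i) := rfl
      _ ≤ ∑ i, r ^ k * F (g * x i) := Finset.sum_le_sum fun i _ => ih _
      _ = r ^ k * ∑ i, F (g * x i) := by rw [Finset.mul_sum]
      _ ≤ r ^ k * (r * F g) := mul_le_mul_of_nonneg_left (hF g) (pow_nonneg hr k)
      _ = r ^ (k + 1) * F g := by ring

theorem exp_growth {S : Set Γ} {δ : ℝ} (hS : IsGenSet S) (hδ : IsHyperbolic S δ)
    (hne : Nonelementary Γ) :
    ∃ N : ℕ, 0 < N ∧ ∀ k : ℕ, (3 / 2.97 : ℝ) ^ k ≤ ((ballF hS (k * N)).card : ℝ) := by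
  have hδ0 := hδ.1
  obtain ⟨C, hC, hT⟩ := exists_triples hS hδ hne
  obtain ⟨N, hN⟩ := exists_nat_ge (11 * (C + δ) + 1)
  obtain ⟨x, hxN, hx⟩ := hT N
  have hN0 : (0 : ℝ) < N := by linarith
  obtain ⟨a, ha⟩ : ∃ a : ℝ, a = Real.log (3 / 2) / N := ⟨_, rfl⟩
  have hlog : 0 < Real.log (3 / 2) := Real.log_pos (by norm_num)
  have hlog2 : Real.log (3 / 2) ≤ 1 / 2 := by
    have := Real.log_le_sub_one_of_pos (show (0 : ℝ) < 3 / 2 by norm_num)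
    linarith
  have ha0 : 0 < a := by rw [ha]; positivity
  have haN : a * N = Real.log (3 / 2) := by rw [ha]; field_simp
  have hE : Real.exp (a * N) = 3 / 2 := by rw [haN, Real.exp_log (by norm_num)]
  have hEi : Real.exp (-(a * N)) = 2 / 3 := by rw [Real.exp_neg, hE]; norm_num
  have hsm : Real.exp (2 * a * (C + δ)) ≤ 1.1 := by
    have h1 : 2 * a * (C + δ) ≤ 1 / 11 := by
      have : a * (11 * (C + δ)) ≤ a * N := mul_le_mul_of_nonneg_left (by linarith) ha0.le
      linarith
    have h2 := Real.add_one_le_exp (-(2 * a * (C + δ)))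
    rw [Real.exp_neg] at h2
    have h3 : (10 / 11 : ℝ) ≤ (Real.exp (2 * a * (C + δ)))⁻¹ := by linarith
    have := inv_anti₀ (by norm_num) h3
    rw [inv_inv] at this
    norm_num at this ⊢
    linarith
  have hphi : ∀ g : Γ, ∑ i, Real.exp (-(a * wl S (g * x i))) ≤ 2.97 * Real.exp (-(a * wl S g)) := by
    intro g
    have hterm : ∀ i, Real.exp (-(a * wl S (g * x i))) =
        Real.exp (-(a * wl S g)) * (2 / 3) * Real.exp (2 * a * gp S 1 g⁻¹ (x i)) := by
      intro i
      rw [← hEi, ← Real.exp_add, ← Real.exp_add, wl_mul_eq hS, hxN]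
      congr 1; ring
    have hgood : ∀ i, gp S 1 g⁻¹ (x i) ≤ C + δ →
        Real.exp (-(a * wl S (g * x i))) ≤ 0.735 * Real.exp (-(a * wl S g)) := by
      intro i hi
      rw [hterm]
      have h1 : Real.exp (2 * a * gp S 1 g⁻¹ (x i)) ≤ 1.1 :=
        (Real.exp_le_exp.2 (mul_le_mul_of_nonneg_left hi (by linarith))).trans hsm
      have h2 := Real.exp_pos (-(a * wl S g))
      nlinarith
    have hbad : ∀ i, Real.exp (-(a * wl S (g * x i))) ≤ 1.5 * Real.exp (-(a * wl S g)) := by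
      intro i
      have h1 : (wl S g : ℝ) ≤ wl S (g * x i) + N := by
        have := wl_mul_le hS (g * x i) (x i)⁻¹
        rw [wl_inv hS, hxN, mul_inv_cancel_right] at this
        exact_mod_cast this
      rw [show (1.5 : ℝ) = Real.exp (a * N) by rw [hE]; norm_num, ← Real.exp_add]
      apply Real.exp_le_exp.2
      nlinarith
    have hpos := Real.exp_pos (-(a * wl S g))
    have hor : ∀ i j, i ≠ j → gp S 1 g⁻¹ (x i) ≤ C + δ ∨ gp S 1 g⁻¹ (x j) ≤ C + δ := by
      intro i j hij
      have := hx i j hij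
      rcases hyp_or hδ (x i) (x j) g⁻¹ with h | h
      · left; rw [gp_comm hS]; linarith
      · right; rw [gp_comm hS]; linarith
    rw [Fin.sum_univ_three]
    have b0 := hbad 0
    have b1 := hbad 1
    have b2 := hbad 2
    rcases hor 0 1 (by decide) with h | h
    · have g0 := hgood 0 h
      rcases hor 1 2 (by decide) with h' | h'
      · have := hgood 1 h'; linarith
      · have := hgood 2 h'; linarith
    · have g1 := hgood 1 h
      rcases hor 0 2 (by decide) with h' | h'
      · have := hgood 0 h'; linarith
      · have := hgood 2 h'; linarith
  refine ⟨N, by exact_mod_cast hN0, fun k => ?_⟩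
  have key : (3 : ℝ) ^ k ≤ (ballF hS (k * N)).card * 2.97 ^ k := by
    calc (3 : ℝ) ^ k = Tk x k (fun _ => 1) 1 := (Tk_const x k 1).symm
      _ ≤ Tk x k (fun h => ∑ y ∈ ballF hS (k * N), Real.exp (-(a * wl S (y⁻¹ * h)))) 1 := by
          apply Tk_mono hS x N hxN
          intro w hw
          rw [one_mul]
          refine le_trans ?_ (Finset.single_le_sum (f := fun y => Real.exp (-(a * wl S (y⁻¹ * w))))
            (fun y _ => (Real.exp_pos _).le) ((mem_ballF hS).2 hw))
          simp [wl_one]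
      _ = ∑ y ∈ ballF hS (k * N), Tk x k (fun h => Real.exp (-(a * wl S (y⁻¹ * h)))) 1 :=
          Tk_sum x _ (fun y h => Real.exp (-(a * wl S (y⁻¹ * h)))) k 1
      _ ≤ ∑ y ∈ ballF hS (k * N), (2.97 : ℝ) ^ k := by
          refine Finset.sum_le_sum fun y _ => ?_
          refine (Tk_eig x _ 2.97 (by norm_num) (fun g => ?_) k 1).trans ?_
          · have := hphi (y⁻¹ * g)
            simpa only [mul_assoc] using this
          · refine mul_le_of_le_one_right (by positivity) ?_
            apply Real.exp_le_one_iff.2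
            have : (0 : ℝ) ≤ a * wl S (y⁻¹ * 1) := by positivity
            linarith
      _ = (ballF hS (k * N)).card * 2.97 ^ k := by simp
  rw [div_pow, div_le_iff₀ (by positivity)]
  exact key

theorem growth_rate {S : Set Γ} {δ : ℝ} (hS : IsGenSet S) (hδ : IsHyperbolic S δ)
    (hne : Nonelementary Γ) :
    ∃ v K : ℝ, 0 < v ∧ 1 ≤ K ∧ (∀ n : ℕ, Real.exp (v * n) ≤ ((ballF hS n).card : ℝ)) ∧
      ∀ n : ℕ, ((ballF hS n).card : ℝ) ≤ K * Real.exp (5 / 4 * v * n) := by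
  obtain ⟨N, hN0, hN⟩ := exp_growth hS hδ hne
  have hb1 : ∀ n, (1 : ℝ) ≤ ((ballF hS n).card : ℝ) := fun n => by
    exact_mod_cast ballF_card_pos hS n
  obtain ⟨u, hu⟩ : ∃ u : ℕ → ℝ, u = fun n => Real.log ((ballF hS n).card : ℝ) := ⟨_, rfl⟩
  have hu0 : ∀ n, 0 ≤ u n := fun n => by rw [hu]; exact Real.log_nonneg (hb1 n)
  have hexp : ∀ n, Real.exp (u n) = ((ballF hS n).card : ℝ) := fun n => by
    rw [hu]; exact Real.exp_log (by linarith [hb1 n])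
  have hsub : Subadditive u := by
    intro m n
    rw [← Real.exp_le_exp, Real.exp_add, hexp, hexp, hexp]
    exact_mod_cast ballF_card_add hS m n
  have hbdd : BddBelow (Set.range fun n => u n / n) := by
    refine ⟨0, ?_⟩
    rintro _ ⟨n, rfl⟩
    exact div_nonneg (hu0 n) (Nat.cast_nonneg n)
  have ht := hsub.tendsto_lim hbdd
  have hN0' : (0 : ℝ) < N := by exact_mod_cast hN0
  have hv : 0 < hsub.lim := by
    have hl : 0 < Real.log (3 / 2.97) := Real.log_pos (by norm_num)
    have : Real.log (3 / 2.97) / N ≤ hsub.lim := by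
      have h2 : Tendsto (fun k : ℕ => u (k * N) / ((k * N : ℕ) : ℝ)) atTop (𝓝 hsub.lim) :=
        ht.comp (tendsto_id.atTop_mul_const' hN0)
      refine ge_of_tendsto h2 ?_
      filter_upwards [eventually_gt_atTop 0] with k hk
      have hk' : (0 : ℝ) < k := by exact_mod_cast hk
      push_cast
      rw [div_le_div_iff₀ hN0' (by positivity)]
      have : (k : ℝ) * Real.log (3 / 2.97) ≤ u (k * N) := by
        rw [← Real.exp_le_exp, hexp, mul_comm, Real.exp_mul, Real.exp_log (by norm_num)]
        exact_mod_cast hN k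
      nlinarith
    exact lt_of_lt_of_le (by positivity) this
  have hev : ∀ᶠ n : ℕ in atTop, u n / n < 5 / 4 * hsub.lim :=
    ht.eventually (gt_mem_nhds (by linarith))
  obtain ⟨n0, hn0⟩ := eventually_atTop.1 hev
  refine ⟨hsub.lim, ((ballF hS n0).card : ℝ), hv, hb1 n0, fun n => ?_, fun n => ?_⟩
  · rcases Nat.eq_zero_or_pos n with rfl | hn
    · simpa using hb1 0
    · rw [← hexp, Real.exp_le_exp]
      have := hsub.lim_le_div hbdd hn.ne'
      rw [le_div_iff₀ (by exact_mod_cast hn)] at this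
      exact this
  · have he : (1 : ℝ) ≤ Real.exp (5 / 4 * hsub.lim * n) := Real.one_le_exp (by positivity)
    rcases le_or_gt n n0 with h | h
    · have : ((ballF hS n).card : ℝ) ≤ ((ballF hS n0).card : ℝ) := by
        exact_mod_cast Finset.card_le_card fun g hg =>
          (mem_ballF hS).2 (((mem_ballF hS).1 hg).trans h)
      nlinarith [hb1 n0]
    · have h1 := hn0 n h.le
      rw [div_lt_iff₀ (by exact_mod_cast Nat.pos_of_ne_zero (by omega))] at h1
      rw [← hexp n]
      have := Real.exp_le_exp.2 h1.le
      nlinarith [hb1 n0]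

theorem ball_fiber {S : Set Γ} {δ : ℝ} (hS : IsGenSet S) (hδ : IsHyperbolic S δ) (D : ℕ)
    (hD : 2 * δ ≤ D) (h : Γ) (n j : ℕ) (F : Finset Γ)
    (hF : ∀ s ∈ F, wl S s = n ∧ (j : ℝ) ≤ gp S 1 h s) :
    (F.card : ℝ) ≤ ((ballF hS (n - j)).card : ℝ) * ((ballF hS D).card : ℝ) := by
  classical
  rcases F.eq_empty_or_nonempty with rfl | ⟨s0, hs0⟩
  · simp; positivity
  have hjh : j ≤ wl S h := by
    exact_mod_cast ((hF s0 hs0).2.trans (gp_le_left hS h s0))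
  have hjn : j ≤ n := by
    have := ((hF s0 hs0).2.trans ((gp_comm hS 1 h s0).le.trans (gp_le_left hS s0 h)))
    rw [(hF s0 hs0).1] at this
    exact_mod_cast this
  obtain ⟨p, hp, hp'⟩ := wl_prefix hS h j hjh
  have key : F.card ≤ (ballF hS (n - j + D)).card := by
    refine Finset.card_le_card_of_injOn (fun s => p⁻¹ * s) ?_ ?_
    · intro s hs
      rw [Finset.mem_coe, mem_ballF]
      have h1 := hyp_base hδ 1 p s h
      have h2 : gp S 1 p h = j := by
        rw [gp_one hS, hp]
        have : (wl S (p⁻¹ * h) : ℝ) + j = wl S h := by exact_mod_cast hp'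
        linarith
      have h3 := (hF s hs).2
      rw [gp_comm hS] at h3
      rw [h2, min_eq_left h3] at h1
      rw [gp_one hS, hp, (hF s hs).1] at h1
      have : (wl S (p⁻¹ * s) : ℝ) ≤ ((n - j + D : ℕ) : ℝ) := by
        push_cast [hjn]; linarith
      exact_mod_cast this
    · intro a _ b _ hab
      simpa using hab
  have := key.trans (ballF_card_add hS (n - j) D)
  exact_mod_cast this

theorem schur_fun {S : Set Γ} {δ : ℝ} (hS : IsGenSet S) (hδ : IsHyperbolic S δ)
    (hne : Nonelementary Γ) :
    ∃ φ : Γ → ℝ, (∀ g, 0 < φ g) ∧ ∃ N : ℕ, ∀ g,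
      ∑ s ∈ ballF hS N, φ (g * s) ≤ 1 / 2 * ((ballF hS N).card : ℝ) * φ g := by
  classical
  obtain ⟨v, K, hv, hK, hlow, hup⟩ := growth_rate hS hδ hne
  obtain ⟨D, hD⟩ := exists_nat_ge (2 * δ)
  obtain ⟨c, hc⟩ : ∃ c : ℝ, c = ((ballF hS D).card : ℝ) := ⟨_, rfl⟩
  have hc0 : 0 ≤ c := by rw [hc]; positivity
  have hlim : Tendsto (fun N : ℕ => (N + 1 : ℝ) ^ 2 * Real.exp (- (v / 4 * (N + 1 : ℝ)))) atTop (𝓝 0) := by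
    have h1 := (Real.tendsto_pow_mul_exp_neg_atTop_nhds_zero 2)
    have h2 : Tendsto (fun N : ℕ => v / 4 * (N + 1 : ℝ)) atTop atTop :=
      (tendsto_atTop_add_const_right _ _ tendsto_natCast_atTop_atTop).const_mul_atTop (by positivity)
    have h3 := (h1.comp h2).const_mul ((v / 4)⁻¹ ^ 2)
    rw [mul_zero] at h3
    refine h3.congr fun N => ?_
    simp only [Function.comp]
    field_simp
  have hM : 0 < 2 * K * (c + 1) * Real.exp v * Real.exp (v / 4) := by positivity
  obtain ⟨N, hN⟩ := (hlim.eventually (gt_mem_nhds (inv_pos.2 hM))).exists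
  refine ⟨fun g => Real.exp (-(v / 2 * wl S g)), fun g => Real.exp_pos _, N, fun g => ?_⟩
  obtain ⟨J, hJ⟩ : ∃ J : Γ → ℕ, J = fun s => ⌊gp S 1 g⁻¹ s⌋₊ := ⟨_, rfl⟩
  have hJ1 : ∀ s, (J s : ℝ) ≤ gp S 1 g⁻¹ s := fun s => by
    rw [hJ]; exact Nat.floor_le (gp_nonneg hS _ _)
  have hJ2 : ∀ s, gp S 1 g⁻¹ s ≤ J s + 1 := fun s => by
    rw [hJ]; exact (Nat.lt_floor_add_one _).le
  have hJ3 : ∀ s, J s ≤ wl S s := fun s => by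
    have := (hJ1 s).trans ((gp_comm hS 1 g⁻¹ s).le.trans (gp_le_left hS s g⁻¹))
    exact_mod_cast this
  have hmaps : ∀ s ∈ ballF hS N, (wl S s, J s) ∈ Finset.range (N + 1) ×ˢ Finset.range (N + 1) := by
    intro s hs
    have := (mem_ballF hS).1 hs
    have := hJ3 s
    simp; omega
  have hfib : ∀ q ∈ Finset.range (N + 1) ×ˢ Finset.range (N + 1),
      ∑ s ∈ (ballF hS N).filter (fun s => (wl S s, J s) = q), Real.exp (-(v / 2 * wl S (g * s))) ≤
      Real.exp (-(v / 2 * wl S g)) * (K * c * Real.exp v * Real.exp (3 / 4 * v * N)) := by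
    rintro ⟨n, j⟩ hq
    have hn : (n : ℝ) ≤ N := by
      have := (Finset.mem_product.1 hq).1
      simp at this
      exact_mod_cast (by omega : n ≤ N)
    set F := (ballF hS N).filter (fun s => (wl S s, J s) = (n, j)) with hFdef
    have hF : ∀ s ∈ F, wl S s = n ∧ J s = j := by
      intro s hs
      have := (Finset.mem_filter.1 hs).2
      exact Prod.mk.inj this
    rcases F.eq_empty_or_nonempty with he | ⟨s0, hs0⟩
    · rw [he]; simp; positivity
    have hjn : j ≤ n := by
      have := hJ3 s0
      rw [(hF s0 hs0).1, (hF s0 hs0).2] at this; exact this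
    have hcard := ball_fiber hS hδ D hD g⁻¹ n j F (fun s hs => ⟨(hF s hs).1, by
      have := hJ1 s; rwa [(hF s hs).2] at this⟩)
    rw [← hc] at hcard
    have hterm : ∀ s ∈ F, Real.exp (-(v / 2 * wl S (g * s))) ≤
        Real.exp (-(v / 2 * wl S g)) * Real.exp (v / 2 * (2 * j + 2 - n)) := by
      intro s hs
      rw [← Real.exp_add, Real.exp_le_exp, wl_mul_eq hS, (hF s hs).1]
      have := hJ2 s
      rw [(hF s hs).2] at this
      nlinarith
    refine (Finset.sum_le_card_nsmul _ _ _ hterm).trans ?_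
    rw [nsmul_eq_mul]
    have h2 := hup (n - j)
    push_cast [hjn] at h2
    have h3 : (F.card : ℝ) ≤ K * Real.exp (5 / 4 * v * (n - j)) * c :=
      hcard.trans (mul_le_mul_of_nonneg_right h2 hc0)
    have hj0 : (0 : ℝ) ≤ j := Nat.cast_nonneg j
    have h4 : Real.exp (5 / 4 * v * (n - j)) * Real.exp (v / 2 * (2 * j + 2 - n)) ≤
        Real.exp v * Real.exp (3 / 4 * v * N) := by
      rw [← Real.exp_add, ← Real.exp_add, Real.exp_le_exp]
      nlinarith
    calc (F.card : ℝ) * (Real.exp (-(v / 2 * wl S g)) * Real.exp (v / 2 * (2 * j + 2 - n)))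
        ≤ K * Real.exp (5 / 4 * v * (n - j)) * c *
          (Real.exp (-(v / 2 * wl S g)) * Real.exp (v / 2 * (2 * j + 2 - n))) :=
          mul_le_mul_of_nonneg_right h3 (by positivity)
      _ = Real.exp (-(v / 2 * wl S g)) * (K * c) *
          (Real.exp (5 / 4 * v * (n - j)) * Real.exp (v / 2 * (2 * j + 2 - n))) := by ring
      _ ≤ Real.exp (-(v / 2 * wl S g)) * (K * c) * (Real.exp v * Real.exp (3 / 4 * v * N)) :=
          mul_le_mul_of_nonneg_left h4 (by positivity)
      _ = _ := by ring
  calc ∑ s ∈ ballF hS N, Real.exp (-(v / 2 * wl S (g * s)))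
      = ∑ q ∈ Finset.range (N + 1) ×ˢ Finset.range (N + 1),
        ∑ s ∈ (ballF hS N).filter (fun s => (wl S s, J s) = q), Real.exp (-(v / 2 * wl S (g * s))) :=
        (Finset.sum_fiberwise_of_maps_to hmaps _).symm
    _ ≤ (Finset.range (N + 1) ×ˢ Finset.range (N + 1)).card •
        (Real.exp (-(v / 2 * wl S g)) * (K * c * Real.exp v * Real.exp (3 / 4 * v * N))) :=
        Finset.sum_le_card_nsmul _ _ _ hfib
    _ = (N + 1 : ℝ) ^ 2 * (K * c * Real.exp v * Real.exp (3 / 4 * v * N)) * Real.exp (-(v / 2 * wl S g)) := by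
        rw [nsmul_eq_mul]; simp; ring
    _ ≤ 1 / 2 * ((ballF hS N).card : ℝ) * Real.exp (-(v / 2 * wl S g)) := by
        refine mul_le_mul_of_nonneg_right ?_ (Real.exp_pos _).le
        have h1 := hlow N
        rw [lt_inv_comm₀ (by positivity) hM, ← one_div, lt_div_iff₀ (by positivity)] at hN
        have e1 : Real.exp (3 / 4 * v * N) = Real.exp (v / 4) * Real.exp (-(v / 4 * (N + 1 : ℝ))) * Real.exp (v * N) := by
          rw [← Real.exp_add, ← Real.exp_add]; congr 1; ring
        rw [e1]
        have hA : 0 ≤ (N + 1 : ℝ) ^ 2 * K * Real.exp v * Real.exp (v / 4) * Real.exp (-(v / 4 * (N + 1 : ℝ))) := by positivity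
        have hB : (N + 1 : ℝ) ^ 2 * K * c * Real.exp v * Real.exp (v / 4) * Real.exp (-(v / 4 * (N + 1 : ℝ))) ≤ 1 / 2 := by
          nlinarith
        calc _ = (N + 1 : ℝ) ^ 2 * K * c * Real.exp v * Real.exp (v / 4) * Real.exp (-(v / 4 * (N + 1 : ℝ))) * Real.exp (v * N) := by ring
          _ ≤ 1 / 2 * Real.exp (v * N) := mul_le_mul_of_nonneg_right hB (Real.exp_pos _).le
          _ ≤ _ := mul_le_mul_of_nonneg_left h1 (by norm_num)

theorem amgmE (a b : ℝ≥0∞) : 2 * (a * b) ≤ a ^ 2 + b ^ 2 := by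
  rcases le_total a b with h | h <;> obtain ⟨d, rfl⟩ := exists_add_of_le h
  · calc 2 * (a * (a + d)) ≤ 2 * (a * (a + d)) + d ^ 2 := le_self_add
      _ = _ := by ring
  · calc 2 * ((b + d) * b) ≤ 2 * ((b + d) * b) + d ^ 2 := le_self_add
      _ = _ := by ring

theorem csE {ι : Type*} (W f : ι → ℝ≥0∞) :
    (∑' s, W s * f s) ^ 2 ≤ (∑' s, W s) * ∑' s, W s * f s ^ 2 := by
  have h2 : (2 : ℝ≥0∞) * (∑' s, W s * f s) ^ 2 ≤ 2 * ((∑' s, W s) * ∑' s, W s * f s ^ 2) := by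
    have e1 : (2 : ℝ≥0∞) * (∑' s, W s * f s) ^ 2 = ∑' s, ∑' t, W s * W t * (2 * (f s * f t)) := by
      rw [sq, ← ENNReal.tsum_mul_right, ← ENNReal.tsum_mul_left]
      refine tsum_congr fun s => ?_
      rw [← ENNReal.tsum_mul_left, ← ENNReal.tsum_mul_left]
      exact tsum_congr fun t => by ring
    have e2 : ∑' s, ∑' t, W s * W t * (f t ^ 2) = (∑' s, W s) * ∑' s, W s * f s ^ 2 := by
      rw [← ENNReal.tsum_mul_right]
      refine tsum_congr fun s => ?_
      rw [← ENNReal.tsum_mul_left]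
      exact tsum_congr fun t => by ring
    have e3 : ∑' s, ∑' t, W s * W t * (f s ^ 2) = (∑' s, W s) * ∑' s, W s * f s ^ 2 := by
      rw [ENNReal.tsum_comm, ← e2]
      exact tsum_congr fun s => tsum_congr fun t => by ring
    calc _ = _ := e1
      _ ≤ ∑' s, ∑' t, W s * W t * (f s ^ 2 + f t ^ 2) :=
        ENNReal.tsum_le_tsum fun s => ENNReal.tsum_le_tsum fun t => by
          gcongr; exact amgmE _ _
      _ = ∑' s, ∑' t, W s * W t * (f s ^ 2) + ∑' s, ∑' t, W s * W t * (f t ^ 2) := by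
        rw [← ENNReal.tsum_add]
        refine tsum_congr fun s => ?_
        rw [← ENNReal.tsum_add]
        exact tsum_congr fun t => by ring
      _ = _ := by rw [e2, e3]; ring
  exact (ENNReal.mul_le_mul_iff_right (by norm_num) (by norm_num)).1 h2

/-- mixing form of the convexity inequality -/
theorem mixE {ι : Type*} (a p : ℝ≥0∞) (W f : ι → ℝ≥0∞) (h : a + ∑' s, W s = 1) :
    (a * p + ∑' s, W s * f s) ^ 2 ≤ a * p ^ 2 + ∑' s, W s * f s ^ 2 := by
  have h1 := csE W f
  have h2 : 2 * (a * p * ∑' s, W s * f s) ≤ a * ((∑' s, W s) * p ^ 2 + ∑' s, W s * f s ^ 2) := by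
    rw [← ENNReal.tsum_mul_left, ← ENNReal.tsum_mul_left, ← ENNReal.tsum_mul_right,
      ← ENNReal.tsum_add, ← ENNReal.tsum_mul_left]
    refine ENNReal.tsum_le_tsum fun s => ?_
    calc 2 * (a * p * (W s * f s)) = a * W s * (2 * (p * f s)) := by ring
      _ ≤ a * W s * (p ^ 2 + f s ^ 2) := by gcongr; exact amgmE _ _
      _ = _ := by ring
  calc (a * p + ∑' s, W s * f s) ^ 2
      = (a * p) ^ 2 + 2 * (a * p * ∑' s, W s * f s) + (∑' s, W s * f s) ^ 2 := by ring
    _ ≤ (a * p) ^ 2 + a * ((∑' s, W s) * p ^ 2 + ∑' s, W s * f s ^ 2) +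
        (∑' s, W s) * ∑' s, W s * f s ^ 2 := by gcongr
    _ = (a + ∑' s, W s) * (a * p ^ 2 + ∑' s, W s * f s ^ 2) := by ring
    _ = _ := by rw [h, one_mul]

/-- square of the `ℓ²`-norm -/
noncomputable def nrm (f : Γ → ℝ≥0∞) : ℝ≥0∞ := ∑' y, f y ^ 2

theorem nrm_trans (f : Γ → ℝ≥0∞) (s : Γ) : ∑' y, f (y * s) ^ 2 = nrm f :=
  (Equiv.mulRight s).tsum_eq (fun y => f y ^ 2)

theorem schurE (B : Finset Γ) (hB : ∀ s ∈ B, s⁻¹ ∈ B) (φ : Γ → ℝ≥0∞) (hφ : ∀ g, φ g ≠ 0)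
    (hφ' : ∀ g, φ g ≠ ⊤) (κ : ℝ≥0∞) (hκ : ∀ g, ∑ s ∈ B, φ (g * s) ≤ κ * φ g) (f : Γ → ℝ≥0∞) :
    nrm (fun y => ∑ s ∈ B, f (y * s)) ≤ κ ^ 2 * nrm f := by
  classical
  have hpt : ∀ y, (∑ s ∈ B, f (y * s)) ^ 2 ≤
      κ * ∑ s ∈ B, φ (y * s * s⁻¹) * (φ (y * s) * (f (y * s) / φ (y * s)) ^ 2) := by
    intro y
    have h1 := csE (fun s : B => φ (y * s)) (fun s : B => f (y * s) / φ (y * s))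
    simp only [tsum_fintype] at h1
    have e : ∀ s : B, φ (y * s) * (f (y * s) / φ (y * s)) = f (y * s) := fun s =>
      ENNReal.mul_div_cancel (hφ _) (hφ' _)
    simp only [e] at h1
    rw [Finset.sum_coe_sort B (fun s => f (y * s)), Finset.sum_coe_sort B (fun s => φ (y * s)),
      Finset.sum_coe_sort B (fun s => φ (y * s) * (f (y * s) / φ (y * s)) ^ 2)] at h1
    refine h1.trans ?_
    simp only [mul_inv_cancel_right]
    rw [← Finset.mul_sum, ← mul_assoc]
    gcongr
    exact hκ y
  calc nrm (fun y => ∑ s ∈ B, f (y * s))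
      ≤ ∑' y, κ * ∑ s ∈ B, φ (y * s * s⁻¹) * (φ (y * s) * (f (y * s) / φ (y * s)) ^ 2) :=
        ENNReal.tsum_le_tsum hpt
    _ = κ * ∑ s ∈ B, ∑' y, φ (y * s * s⁻¹) * (φ (y * s) * (f (y * s) / φ (y * s)) ^ 2) := by
        rw [ENNReal.tsum_mul_left, Summable.tsum_finsetSum (fun _ _ => ENNReal.summable)]
    _ = κ * ∑ s ∈ B, ∑' z, φ (z * s⁻¹) * (φ z * (f z / φ z) ^ 2) := by
        congr 1
        refine Finset.sum_congr rfl fun s _ => ?_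
        exact (Equiv.mulRight s).tsum_eq (fun z => φ (z * s⁻¹) * (φ z * (f z / φ z) ^ 2))
    _ = κ * ∑' z, (∑ s ∈ B, φ (z * s⁻¹)) * (φ z * (f z / φ z) ^ 2) := by
        rw [← Summable.tsum_finsetSum (fun _ _ => ENNReal.summable)]
        congr 1
        exact tsum_congr fun z => by rw [Finset.sum_mul]
    _ ≤ κ * ∑' z, κ * f z ^ 2 := by
        refine mul_le_mul_right (ENNReal.tsum_le_tsum fun z => ?_) κ
        have e1 : ∑ s ∈ B, φ (z * s⁻¹) = ∑ s ∈ B, φ (z * s) :=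
          Finset.sum_bij' (fun s _ => s⁻¹) (fun s _ => s⁻¹) hB hB (by simp) (by simp) (by simp)
        rw [e1]
        calc _ ≤ κ * φ z * (φ z * (f z / φ z) ^ 2) := by gcongr; exact hκ z
          _ = κ * (φ z * (f z / φ z)) ^ 2 := by ring
          _ = _ := by rw [ENNReal.mul_div_cancel (hφ _) (hφ' _)]
    _ = _ := by rw [ENNReal.tsum_mul_left, ← mul_assoc, sq]; rfl

/-- Markov operator -/
noncomputable def op (w f : Γ → ℝ≥0∞) (y : Γ) : ℝ≥0∞ := ∑' s, w s * f (y * s)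

open Classical in
noncomputable def Wn (w : Γ → ℝ≥0∞) : ℕ → Γ → ℝ≥0∞
  | 0 => fun g => if g = 1 then 1 else 0
  | n + 1 => fun g => ∑' s, w s * Wn w n (s⁻¹ * g)

theorem op_iter (w f : Γ → ℝ≥0∞) (n : ℕ) (y : Γ) :
    (op w)^[n] f y = ∑' g, Wn w n g * f (y * g) := by
  classical
  induction n generalizing y with
  | zero =>
    rw [tsum_eq_single 1 (by intro b hb; simp [Wn, hb])]
    simp [Wn]
  | succ n ih =>
    rw [Function.iterate_succ_apply', op]
    simp only [ih, Wn, ← ENNReal.tsum_mul_left, ← ENNReal.tsum_mul_right]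
    rw [ENNReal.tsum_comm (f := fun g s => w s * Wn w n (s⁻¹ * g) * f (y * g))]
    refine tsum_congr fun s => ?_
    rw [← (Equiv.mulLeft s).tsum_eq (fun g => w s * Wn w n (s⁻¹ * g) * f (y * g))]
    exact tsum_congr fun g => by simp [mul_assoc]

theorem op_one (w : Γ → ℝ≥0∞) (hw : ∑' s, w s = 1) (n : ℕ) : ∑' g, Wn w n g = 1 := by
  have h : ∀ n y, (op w)^[n] (fun _ => 1) y = 1 := by
    intro n
    induction n with
    | zero => intro y; rfl
    | succ n ih => intro y; rw [Function.iterate_succ_apply', op]; simp [ih, hw]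
  have := h n 1
  rw [op_iter] at this
  simpa using this

theorem op_nrm (w f : Γ → ℝ≥0∞) (hw : ∑' s, w s = 1) : nrm (op w f) ≤ nrm f := by
  calc nrm (op w f) ≤ ∑' y, ∑' s, w s * f (y * s) ^ 2 := by
        refine ENNReal.tsum_le_tsum fun y => ?_
        have := csE w (fun s => f (y * s))
        rwa [hw, one_mul] at this
    _ = ∑' s, w s * nrm f := by
        rw [ENNReal.tsum_comm]
        refine tsum_congr fun s => ?_
        rw [ENNReal.tsum_mul_left, nrm_trans]
    _ = nrm f := by rw [ENNReal.tsum_mul_right, hw, one_mul]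

/-- the key contraction -/
theorem op_contract {S : Set Γ} {δ : ℝ} (hS : IsGenSet S) (hδ : IsHyperbolic S δ)
    (hne : Nonelementary Γ) (w : Γ → ℝ≥0∞) (hw : ∑' s, w s = 1)
    (hpos : ∀ N, ∃ k, ∀ g ∈ ballF hS N, Wn w k g ≠ 0) :
    ∃ k : ℕ, ∃ ρ : ℝ≥0∞, ρ < 1 ∧ ∀ f, nrm ((op w)^[k] f) ≤ ρ * nrm f := by
  classical
  obtain ⟨φ, hφ, N, hN⟩ := schur_fun hS hδ hne
  obtain ⟨k, hk⟩ := hpos N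
  obtain ⟨b, hb⟩ : ∃ b : ℕ, b = (ballF hS N).card := ⟨_, rfl⟩
  have hb0 : 0 < b := hb ▸ ballF_card_pos hS N
  obtain ⟨c, hc0, hc⟩ : ∃ c : ℝ≥0∞, c ≠ 0 ∧ ∀ g ∈ ballF hS N, c ≤ Wn w k g := by
    refine ⟨(ballF hS N).inf (Wn w k), ?_, fun g hg => Finset.inf_le hg⟩
    have : 0 < (ballF hS N).inf (Wn w k) :=
      (Finset.lt_inf_iff (by simp)).2 fun g hg => pos_iff_ne_zero.2 (hk g hg)
    exact this.ne'
  obtain ⟨I, hI⟩ : ∃ I : Γ → ℝ≥0∞, I = fun g => if g ∈ ballF hS N then c else 0 := ⟨_, rfl⟩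
  have hIW : ∀ g, I g ≤ Wn w k g := by
    intro g; rw [hI]; dsimp only; split_ifs with h
    · exact hc g h
    · exact zero_le
  have hIsum : ∀ f : Γ → ℝ≥0∞, ∑' g, I g * f g = c * ∑ g ∈ ballF hS N, f g := by
    intro f
    rw [tsum_eq_sum (s := ballF hS N) (by intro g hg; simp [hI, hg]), Finset.mul_sum]
    exact Finset.sum_congr rfl fun g hg => by simp [hI, hg]
  obtain ⟨V, hV⟩ : ∃ V : Γ → ℝ≥0∞, V = fun g => Wn w k g - I g := ⟨_, rfl⟩
  have hWV : ∀ g, Wn w k g = I g + V g := fun g => by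
    rw [hV]; exact (add_tsub_cancel_of_le (hIW g)).symm
  have htot : c * b + ∑' g, V g = 1 := by
    have h1 := op_one w hw k
    simp only [hWV] at h1
    rw [ENNReal.tsum_add] at h1
    have h2 := hIsum (fun _ => 1)
    simp only [mul_one, Finset.sum_const, nsmul_eq_mul] at h2
    rw [h2, ← hb] at h1
    exact h1
  have hbE : (b : ℝ≥0∞) ≠ 0 := by exact_mod_cast hb0.ne'
  have hbT : (b : ℝ≥0∞) ≠ ⊤ := ENNReal.natCast_ne_top b
  have hcT : c * b ≠ ⊤ := ne_top_of_le_ne_top ENNReal.one_ne_top (htot ▸ le_self_add)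
  have hVT : ∑' g, V g ≠ ⊤ := ne_top_of_le_ne_top ENNReal.one_ne_top (htot ▸ le_add_self)
  refine ⟨k, c * b * (1 / 2) ^ 2 + ∑' g, V g, ?_, fun f => ?_⟩
  · conv_rhs => rw [← htot]
    refine ENNReal.add_lt_add_right hVT ?_
    have h0 : c * b ≠ 0 := mul_ne_zero hc0 hbE
    conv_rhs => rw [← mul_one (c * b)]
    refine ENNReal.mul_lt_mul_right h0 hcT ?_
    refine (pow_le_of_le_one zero_le ?_ two_ne_zero).trans_lt ?_
    · rw [one_div]; exact ENNReal.one_half_lt_one.le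
    · rw [one_div]; exact ENNReal.one_half_lt_one
  · have hsch := schurE (ballF hS N) (fun s hs => by
        rw [mem_ballF] at hs ⊢; rwa [wl_inv hS]) (fun g => ENNReal.ofReal (φ g))
        (fun g => (ENNReal.ofReal_pos.2 (hφ g)).ne') (fun g => ENNReal.ofReal_ne_top) (1 / 2 * b) (fun g => by
          rw [← ENNReal.ofReal_sum_of_nonneg (fun _ _ => (hφ _).le)]
          refine (ENNReal.ofReal_le_ofReal (hN g)).trans (le_of_eq ?_)
          rw [ENNReal.ofReal_mul (mul_nonneg (by norm_num) (Nat.cast_nonneg _)), ENNReal.ofReal_mul (by norm_num), ← hb]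
          rw [ENNReal.ofReal_natCast, ENNReal.ofReal_div_of_pos (by norm_num), ENNReal.ofReal_one,
            ENNReal.ofReal_ofNat]) f
    have hpt : ∀ y, ((op w)^[k] f y) ^ 2 ≤
        c * b * ((b : ℝ≥0∞)⁻¹ * ∑ s ∈ ballF hS N, f (y * s)) ^ 2 + ∑' g, V g * f (y * g) ^ 2 := by
      intro y
      refine le_trans (le_of_eq ?_) (mixE (c * b) ((b : ℝ≥0∞)⁻¹ * ∑ s ∈ ballF hS N, f (y * s)) V
        (fun g => f (y * g)) htot)
      congr 1
      rw [op_iter]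
      simp only [hWV, add_mul]
      rw [ENNReal.tsum_add, hIsum (fun g => f (y * g)), mul_assoc c, ← mul_assoc (b : ℝ≥0∞),
        ENNReal.mul_inv_cancel hbE hbT, one_mul]
    calc nrm ((op w)^[k] f) ≤ ∑' y, (c * b * ((b : ℝ≥0∞)⁻¹ * ∑ s ∈ ballF hS N, f (y * s)) ^ 2 +
          ∑' g, V g * f (y * g) ^ 2) := ENNReal.tsum_le_tsum hpt
      _ = c * b * (b : ℝ≥0∞)⁻¹ ^ 2 * nrm (fun y => ∑ s ∈ ballF hS N, f (y * s)) +
          ∑' g, V g * nrm f := by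
          rw [ENNReal.tsum_add, ENNReal.tsum_comm (f := fun y g => V g * f (y * g) ^ 2)]
          simp only [ENNReal.tsum_mul_left, nrm_trans, mul_pow]
          simp only [nrm, mul_assoc]
      _ ≤ c * b * (b : ℝ≥0∞)⁻¹ ^ 2 * ((1 / 2 * b) ^ 2 * nrm f) + ∑' g, V g * nrm f := by gcongr
      _ = (c * b * (1 / 2) ^ 2 * ((b : ℝ≥0∞) * (b : ℝ≥0∞)⁻¹) ^ 2 + ∑' g, V g) * nrm f := by
          rw [ENNReal.tsum_mul_right]; ring
      _ = _ := by rw [ENNReal.mul_inv_cancel hbE hbT, one_pow, mul_one]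

noncomputable def mE (μ : Γ → ℝ) (s : Γ) : ℝ≥0∞ := ENNReal.ofReal (μ s)

theorem mE_total {S : Set Γ} {μ : Γ → ℝ} (hμ : IsRWMeasure S μ) : ∑' s, mE μ s = 1 := by
  have hsum : Summable μ := by
    by_contra h
    have := hμ.total
    rw [tsum_eq_zero_of_not_summable h] at this
    norm_num at this
  have := ENNReal.ofReal_tsum_of_nonneg hμ.nonneg hsum
  rw [hμ.total, ENNReal.ofReal_one] at this
  exact this.symm

open Classical in
noncomputable def sg (z : Γ) : Γ → ℝ≥0∞ := fun g => if g = z then 1 else 0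

noncomputable def nuE (μ : Γ → ℝ) (s : Γ) : ℝ≥0∞ := 2⁻¹ * (sg 1 s + mE μ s)

theorem sg_tsum (z : Γ) (f : Γ → ℝ≥0∞) : ∑' g, sg z g * f g = f z := by
  rw [tsum_eq_single z (by intro b hb; simp [sg, hb])]
  simp [sg]

theorem sg_total (z : Γ) : ∑' g, sg z g = 1 := by
  simpa using sg_tsum z (fun _ => 1)

theorem nuE_total {S : Set Γ} {μ : Γ → ℝ} (hμ : IsRWMeasure S μ) : ∑' s, nuE μ s = 1 := by
  simp only [nuE]
  rw [ENNReal.tsum_mul_left, ENNReal.tsum_add, mE_total hμ, sg_total, one_add_one_eq_two]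
  exact ENNReal.inv_mul_cancel (by norm_num) (by norm_num)

theorem op_nuE (μ : Γ → ℝ) (f : Γ → ℝ≥0∞) (y : Γ) :
    2 * op (nuE μ) f y = f y + op (mE μ) f y := by
  unfold op nuE
  simp only [mul_assoc]
  rw [ENNReal.tsum_mul_left, ← mul_assoc, ENNReal.mul_inv_cancel (by norm_num) (by norm_num),
    one_mul]
  simp only [add_mul]
  rw [ENNReal.tsum_add, sg_tsum 1 (fun s => f (y * s)), mul_one]

theorem op_mono (w : Γ → ℝ≥0∞) {f f' : Γ → ℝ≥0∞} (h : ∀ y, f y ≤ f' y) (y : Γ) :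
    op w f y ≤ op w f' y :=
  ENNReal.tsum_le_tsum fun s => by gcongr; exact h _

theorem op_smul (w : Γ → ℝ≥0∞) (c : ℝ≥0∞) (f : Γ → ℝ≥0∞) (y : Γ) :
    op w (fun z => c * f z) y = c * op w f y := by
  unfold op
  rw [← ENNReal.tsum_mul_left]
  exact tsum_congr fun s => by ring

theorem binom_cmp (μ : Γ → ℝ) (f : Γ → ℝ≥0∞) (n j : ℕ) (y : Γ) :
    (n.choose j : ℝ≥0∞) * (op (mE μ))^[j] f y ≤ 2 ^ n * (op (nuE μ))^[n] f y := by
  induction n generalizing j y with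
  | zero =>
    cases j with
    | zero => simp
    | succ j => simp
  | succ n ih =>
    rw [Function.iterate_succ_apply' (op (nuE μ)) n f, pow_succ, mul_assoc, op_nuE, mul_add]
    have hfirst : ∀ i, (n.choose i : ℝ≥0∞) * op (mE μ) ((op (mE μ))^[i] f) y ≤
        2 ^ n * op (mE μ) ((op (nuE μ))^[n] f) y := by
      intro i
      rw [← op_smul, ← op_smul]
      exact op_mono _ (fun z => ih i z) y
    cases j with
    | zero =>
      have := ih 0 y
      simp only [Nat.choose_zero_right] at this ⊢
      exact this.trans le_self_add
    | succ j =>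
      rw [Nat.choose_succ_succ, Nat.cast_add, add_mul, add_comm]
      refine add_le_add (ih _ _) ?_
      rw [Function.iterate_succ_apply']
      exact hfirst j

theorem Wn_pos {S : Set Γ} {μ : Γ → ℝ} (hS : IsGenSet S) (hμ : IsRWMeasure S μ) (N : ℕ) :
    ∃ k, ∀ g ∈ ballF hS N, Wn (nuE μ) k g ≠ 0 := by
  classical
  have hstep : ∀ n s g, nuE μ s ≠ 0 → Wn (nuE μ) n g ≠ 0 → Wn (nuE μ) (n + 1) (s * g) ≠ 0 := by
    intro n s g h1 h2 h
    have := ENNReal.tsum_eq_zero.1 h s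
    rw [inv_mul_cancel_left] at this
    exact mul_ne_zero h1 h2 this
  have h1 : nuE μ 1 ≠ 0 := by simp [nuE, sg]
  have hmono : ∀ m n g, Wn (nuE μ) n g ≠ 0 → Wn (nuE μ) (n + m) g ≠ 0 := by
    intro m n g h
    induction m with
    | zero => exact h
    | succ m ih => have := hstep _ 1 g h1 ih; rwa [one_mul] at this
  have hex : ∀ g, ∃ n, Wn (nuE μ) n g ≠ 0 := by
    intro g
    obtain ⟨l, -, hl, rfl⟩ := hμ.nondeg g
    refine ⟨l.length, ?_⟩
    induction l with
    | nil => simp [Wn]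
    | cons a l ih =>
      simp only [List.mem_cons, forall_eq_or_imp] at hl
      rw [List.prod_cons, List.length_cons]
      refine hstep _ _ _ ?_ (ih hl.2)
      simp [nuE, mE, hl.1]
  choose n hn using hex
  refine ⟨(ballF hS N).sup n, fun g hg => ?_⟩
  have := Finset.le_sup (f := n) hg
  obtain ⟨m, hm⟩ := Nat.exists_eq_add_of_le this
  rw [hm]
  exact hmono _ _ _ (hn g)

theorem decay {S : Set Γ} {δ : ℝ} (hS : IsGenSet S) (hδ : IsHyperbolic S δ)
    (hne : Nonelementary Γ) {μ : Γ → ℝ} (hμ : IsRWMeasure S μ) :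
    ∃ C l : ℝ, 0 < C ∧ 0 < l ∧ l < 1 ∧ ∀ (m : ℕ) (z y : Γ),
      (op (mE μ))^[m] (sg z) y ≤ ENNReal.ofReal (C * l ^ m) := by
  obtain ⟨k, ρ, hρ, hk⟩ := op_contract hS hδ hne (nuE μ) (nuE_total hμ) (Wn_pos hS hμ)
  obtain ⟨r, hr0, hr1, hρr⟩ : ∃ r : ℝ, 0 < r ∧ r < 1 ∧ ρ ≤ ENNReal.ofReal r := by
    refine ⟨(ρ.toReal + 1) / 2, by positivity, ?_, ?_⟩
    · have : ρ.toReal < 1 := by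
        rw [← ENNReal.toReal_one]
        exact (ENNReal.toReal_lt_toReal hρ.ne_top ENNReal.one_ne_top).2 hρ
      linarith
    · have : ρ.toReal < 1 := by
        rw [← ENNReal.toReal_one]
        exact (ENNReal.toReal_lt_toReal hρ.ne_top ENNReal.one_ne_top).2 hρ
      rw [← ENNReal.ofReal_toReal hρ.ne_top]
      exact ENNReal.ofReal_le_ofReal (by rw [ENNReal.toReal_ofReal (by positivity)]; linarith)
  -- iterate
  have hsg : ∀ z : Γ, nrm (sg z) = 1 := by
    intro z
    have : ∀ g, sg z g ^ 2 = sg z g := by intro g; unfold sg; split_ifs <;> simp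
    simp only [nrm, this, sg_total]
  have hit : ∀ (j q : ℕ) (z : Γ), nrm ((op (nuE μ))^[j + k * q] (sg z)) ≤ ENNReal.ofReal r ^ q := by
    intro j q z
    induction j with
    | zero =>
      rw [Nat.zero_add]
      induction q with
      | zero => simp [hsg]
      | succ q ih =>
        rw [Nat.mul_succ, Nat.add_comm, Function.iterate_add_apply, pow_succ']
        exact (hk _).trans (mul_le_mul' hρr ih)
    | succ j ih =>
      rw [show j + 1 + k * q = (j + k * q) + 1 by ring, Function.iterate_succ_apply']
      exact (op_nrm _ _ (nuE_total hμ)).trans ih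
  have hk0 : 0 < k ∨ k = 0 := by omega
  rcases hk0 with hk0 | hk0
  swap
  · exfalso
    have := hk (sg 1)
    rw [hk0, Function.iterate_zero, id, hsg, mul_one] at this
    exact absurd hρ (not_lt.2 this)
  obtain ⟨l, hl0, hl1, hlr⟩ : ∃ l : ℝ, 0 < l ∧ l < 1 ∧ l ^ (4 * k) = r := by
    refine ⟨r ^ ((4 * k : ℕ) : ℝ)⁻¹, Real.rpow_pos_of_pos hr0 _, ?_, ?_⟩
    · exact Real.rpow_lt_one hr0.le hr1 (by positivity)
    · exact Real.rpow_inv_natCast_pow hr0.le (by positivity)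
  -- bound m * l ^ (3 m)
  obtain ⟨M, hM⟩ : ∃ M : ℝ, ∀ m : ℕ, (m : ℝ) * l ^ m ≤ M := by
    have := (tendsto_self_mul_const_pow_of_lt_one hl0.le hl1).bddAbove_range
    obtain ⟨M, hM⟩ := this
    exact ⟨M, fun m => hM ⟨m, rfl⟩⟩
  have hM0 : 0 ≤ M := by simpa using hM 0
  obtain ⟨C, hCdef⟩ : ∃ C : ℝ, C = (2 * M + 1) * (l ^ (4 * k))⁻¹ := ⟨_, rfl⟩
  have hli : 1 ≤ (l ^ (4 * k))⁻¹ := (one_le_inv₀ (by positivity)).2 (pow_le_one₀ hl0.le hl1.le)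
  have hC1 : 1 ≤ C := by rw [hCdef]; nlinarith
  refine ⟨C, l, by linarith, hl0, hl1, fun m z y => ?_⟩
  rcases Nat.eq_zero_or_pos m with rfl | hm
  · simp only [Function.iterate_zero, id, pow_zero, mul_one]
    refine le_trans ?_ (ENNReal.one_le_ofReal.2 hC1)
    unfold sg; split_ifs <;> simp
  -- lazy value
  obtain ⟨q, hq⟩ : ∃ q, q = 2 * m / k := ⟨_, rfl⟩
  have hq1 : k * q ≤ 2 * m := hq ▸ Nat.mul_div_le _ _
  have hq2 : 2 * m < k * q + k := by
    have := Nat.lt_mul_div_succ (2 * m) hk0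
    rw [← hq] at this; linarith [Nat.mul_succ k q]
  have hlazy : (op (nuE μ))^[2 * m] (sg z) y ≤ ENNReal.ofReal (l ^ (2 * k * q)) := by
    have h1 := hit (2 * m - k * q) q z
    rw [Nat.sub_add_cancel hq1] at h1
    have h2 : ((op (nuE μ))^[2 * m] (sg z) y) ^ 2 ≤ ENNReal.ofReal (l ^ (2 * k * q)) ^ 2 := by
      refine (ENNReal.le_tsum y).trans (h1.trans (le_of_eq ?_))
      rw [← ENNReal.ofReal_pow hr0.le, ← ENNReal.ofReal_pow (by positivity), ← hlr]
      congr 1; ring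
    exact (ENNReal.pow_le_pow_left_iff two_ne_zero).1 h2
  have hb := binom_cmp μ (sg z) (2 * m) m y
  have hcb : (4 : ℝ≥0∞) ^ m ≤ 2 * m * ((2 * m).choose m : ℝ≥0∞) := by
    have := Nat.four_pow_le_two_mul_self_mul_centralBinom m hm
    rw [Nat.centralBinom] at this
    exact_mod_cast this
  have hch : ((2 * m).choose m : ℝ≥0∞) ≠ 0 := by
    have := Nat.choose_pos (show m ≤ 2 * m by omega)
    exact_mod_cast this.ne'
  have hmain : (op (mE μ))^[m] (sg z) y ≤ 2 * m * (op (nuE μ))^[2 * m] (sg z) y := by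
    refine (ENNReal.mul_le_mul_iff_right hch (ENNReal.natCast_ne_top _)).1 (hb.trans ?_)
    rw [pow_mul, show (2 : ℝ≥0∞) ^ 2 = 4 by norm_num]
    calc _ ≤ 2 * m * ((2 * m).choose m : ℝ≥0∞) * (op (nuE μ))^[2 * m] (sg z) y := by gcongr
      _ = _ := by ring
  calc _ ≤ _ := hmain
    _ ≤ 2 * m * ENNReal.ofReal (l ^ (2 * k * q)) := by gcongr
    _ = ENNReal.ofReal (2 * m * l ^ (2 * k * q)) := by
        rw [ENNReal.ofReal_mul (by positivity), ENNReal.ofReal_mul (by norm_num),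
          ENNReal.ofReal_natCast, ENNReal.ofReal_ofNat]
    _ ≤ _ := by
        apply ENNReal.ofReal_le_ofReal
        have h1 : l ^ (2 * k * q) * l ^ (4 * k) ≤ l ^ (2 * m) := by
          rw [← pow_add]
          apply pow_le_pow_of_le_one hl0.le hl1.le
          nlinarith
        have h2 : l ^ (2 * k * q) ≤ l ^ (2 * m) * (l ^ (4 * k))⁻¹ := by
          rw [← div_eq_mul_inv, le_div_iff₀ (by positivity)]; exact h1
        have h3 := hM m
        have h4 : (0 : ℝ) < l ^ m := by positivity
        calc 2 * m * l ^ (2 * k * q) ≤ 2 * m * (l ^ (2 * m) * (l ^ (4 * k))⁻¹) := by gcongr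
          _ = 2 * (m * l ^ m) * (l ^ (4 * k))⁻¹ * l ^ m := by rw [two_mul m, pow_add]; ring
          _ ≤ 2 * M * (l ^ (4 * k))⁻¹ * l ^ m := by gcongr
          _ ≤ C * l ^ m := by
            rw [hCdef]; gcongr; linarith

open Classical in
/-- paths from `x`, staying in `Ω` at all positive times -/
noncomputable def hE (μ : Γ → ℝ) (Ω : Set Γ) : ℕ → Γ → Γ → ℝ≥0∞
  | 0 => fun x y => sg x y
  | n + 1 => fun x y => if y ∈ Ω then ∑' z, hE μ Ω n x z * mE μ (z⁻¹ * y) else 0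

noncomputable def gE (μ : Γ → ℝ) (Ω : Set Γ) (x y : Γ) : ℝ≥0∞ := ∑' n, hE μ Ω n x y

theorem op_sg (w : Γ → ℝ≥0∞) (y z : Γ) : op w (sg y) z = w (z⁻¹ * y) := by
  unfold op
  rw [tsum_eq_single (z⁻¹ * y)]
  · simp [sg]
  · intro s hs
    have : z * s ≠ y := fun h => hs (by rw [← h]; group)
    simp [sg, this]

theorem Wn_eq (w : Γ → ℝ≥0∞) (n : ℕ) (x z : Γ) : (op w)^[n] (sg z) x = Wn w n (x⁻¹ * z) := by
  rw [op_iter, tsum_eq_single (x⁻¹ * z)]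
  · simp [sg]
  · intro s hs
    have : x * s ≠ z := fun h => hs (by rw [← h]; group)
    simp [sg, this]

theorem Wn_right (w : Γ → ℝ≥0∞) (n : ℕ) (x y : Γ) :
    Wn w (n + 1) (x⁻¹ * y) = ∑' z, Wn w n (x⁻¹ * z) * w (z⁻¹ * y) := by
  rw [← Wn_eq, Function.iterate_succ_apply, op_iter]
  simp only [op_sg]
  rw [← (Equiv.mulLeft x).tsum_eq (fun z => Wn w n (x⁻¹ * z) * w (z⁻¹ * y))]
  simp

theorem hE_le_Wn (μ : Γ → ℝ) (Ω : Set Γ) (n : ℕ) (x y : Γ) :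
    hE μ Ω n x y ≤ Wn (mE μ) n (x⁻¹ * y) := by
  induction n generalizing y with
  | zero => 
    rw [← Wn_eq]
    change sg x y ≤ sg y x
    unfold sg
    split_ifs <;> simp_all
  | succ n ih =>
    rw [Wn_right]
    simp only [hE]
    split_ifs
    · exact ENNReal.tsum_le_tsum fun z => by gcongr; exact ih z
    · exact zero_le

theorem hE_sg_le (μ : Γ → ℝ) (Ω : Set Γ) (x y : Γ) : sg x y ≤ gE μ Ω x y :=
  ENNReal.le_tsum (f := fun n => hE μ Ω n x y) 0

theorem gE_self (μ : Γ → ℝ) (Ω : Set Γ) (x : Γ) : 1 ≤ gE μ Ω x x := by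
  refine le_trans ?_ (hE_sg_le μ Ω x x)
  simp [sg]

theorem sum_tsum_comm (f : ℕ → Γ → ℝ≥0∞) (w : Γ → ℝ≥0∞) :
    ∑' n, ∑' z, f n z * w z = ∑' z, (∑' n, f n z) * w z := by
  rw [ENNReal.tsum_comm]
  exact tsum_congr fun z => ENNReal.tsum_mul_right

theorem gE_eq (μ : Γ → ℝ) (Ω : Set Γ) (x y : Γ) (hy : y ∈ Ω) :
    gE μ Ω x y = sg x y + ∑' z, gE μ Ω x z * mE μ (z⁻¹ * y) := by
  have h := tsum_eq_zero_add' (f := fun n => hE μ Ω n x y) ENNReal.summable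
  unfold gE
  rw [h]
  congr 1
  simp only [hE, hy, if_true]
  exact sum_tsum_comm _ _

theorem gE_out (μ : Γ → ℝ) (Ω : Set Γ) (x y : Γ) (hy : y ∉ Ω) : gE μ Ω x y = sg x y := by
  have h := tsum_eq_zero_add' (f := fun n => hE μ Ω n x y) ENNReal.summable
  unfold gE
  rw [h]
  simp [hE, hy]

theorem hE_ck (μ : Γ → ℝ) (Ω : Set Γ) (n m : ℕ) (x u w : Γ) :
    hE μ Ω n x u * hE μ Ω m u w ≤ hE μ Ω (n + m) x w := by
  induction m generalizing w with
  | zero =>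
    simp only [hE, sg, Nat.add_zero]
    split_ifs with h
    · rw [h, mul_one]
    · simp
  | succ m ih =>
    rw [← Nat.add_assoc]
    simp only [hE]
    split_ifs with h
    · rw [← ENNReal.tsum_mul_left]
      refine ENNReal.tsum_le_tsum fun z => ?_
      rw [← mul_assoc]
      gcongr
      exact ih z
    · simp

theorem gE_right (μ : Γ → ℝ) (Ω : Set Γ) (m : ℕ) (x u w : Γ) :
    gE μ Ω x u * hE μ Ω m u w ≤ gE μ Ω x w := by
  unfold gE
  rw [← ENNReal.tsum_mul_right]
  refine (ENNReal.tsum_le_tsum fun n => hE_ck μ Ω n m x u w).trans ?_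
  exact ENNReal.tsum_comp_le_tsum_of_injective (add_left_injective m) (fun n => hE μ Ω n x w)

theorem gE_left (μ : Γ → ℝ) (Ω : Set Γ) (m : ℕ) (x u w : Γ) :
    hE μ Ω m x u * gE μ Ω u w ≤ gE μ Ω x w := by
  unfold gE
  rw [← ENNReal.tsum_mul_left]
  refine (ENNReal.tsum_le_tsum fun n => hE_ck μ Ω m n x u w).trans ?_
  exact ENNReal.tsum_comp_le_tsum_of_injective (add_right_injective m) (fun n => hE μ Ω n x w)

/-- the interior points -/
def inn (S : Set Γ) (k : ℕ) (Δ : Set Γ) : Set Γ := {g | ∀ w, wl S w ≤ k → g * w ∈ Δ}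

theorem hE_list {S : Set Γ} {μ : Γ → ℝ} (hS : IsGenSet S) (hμ : IsRWMeasure S μ) (l : List Γ)
    (hl : ∀ s ∈ l, 0 < μ s) (Δ : Set Γ) (g : Γ) (hg : g ∈ inn S l.length Δ) :
    (l.map (mE μ)).prod ≤ hE μ Δ l.length g (g * l.prod) := by
  induction l generalizing g with
  | nil => simp [hE, sg]
  | cons a l ih =>
    simp only [List.mem_cons, forall_eq_or_imp] at hl
    have ha : wl S a ≤ 1 := wl_gen (hμ.support_subset a hl.1.ne')
    have h1 : mE μ a ≤ hE μ Δ 1 g (g * a) := by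
      simp only [hE]
      rw [if_pos (hg a (ha.trans (by simp)))]
      refine le_trans ?_ (ENNReal.le_tsum g)
      simp [sg]
    have h2 := ih hl.2 (g * a) (by
      intro w hw
      rw [mul_assoc]
      apply hg
      have := wl_mul_le hS a w
      simp only [List.length_cons]; omega)
    rw [List.map_cons, List.prod_cons, List.prod_cons, List.length_cons, Nat.add_comm]
    refine (mul_le_mul' h1 h2).trans ?_
    rw [← mul_assoc]
    exact hE_ck _ _ _ _ _ _ _

theorem harnack0 {S : Set Γ} {μ : Γ → ℝ} (hS : IsGenSet S) (hμ : IsRWMeasure S μ) :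
    ∃ k : ℕ, ∃ K : ℝ≥0∞, 1 ≤ K ∧ K ≠ ⊤ ∧ ∀ s ∈ S, ∀ (Δ : Set Γ) (g : Γ), g ∈ inn S k Δ →
      ∃ m, 1 ≤ K * hE μ Δ m g (g * s) := by
  classical
  choose l _ hl2 hl3 using hμ.nondeg
  have hP0 : ∀ s, ((l s).map (mE μ)).prod ≠ 0 := by
    intro s
    rw [Ne, List.prod_eq_zero_iff]
    simp only [List.mem_map, not_exists, not_and]
    intro a ha
    exact (ENNReal.ofReal_pos.2 (hl2 s a ha)).ne'
  have hPT : ∀ s, ((l s).map (mE μ)).prod ≠ ⊤ := by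
    intro s
    generalize l s = L
    induction L with
    | nil => simp
    | cons a L ih =>
      rw [List.map_cons, List.prod_cons]
      exact ENNReal.mul_ne_top ENNReal.ofReal_ne_top ih
  refine ⟨hS.1.toFinset.sup fun s => (l s).length,
    1 + ∑ s ∈ hS.1.toFinset, (((l s).map (mE μ)).prod)⁻¹, le_self_add, ?_, ?_⟩
  · refine ENNReal.add_ne_top.2 ⟨ENNReal.one_ne_top, ?_⟩
    exact ENNReal.sum_ne_top.2 fun s _ => ENNReal.inv_ne_top.2 (hP0 s)
  · intro s hs Δ g hg
    have hs' : s ∈ hS.1.toFinset := by simpa using hs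
    refine ⟨(l s).length, ?_⟩
    have h1 := hE_list hS hμ (l s) (hl2 s) Δ g (fun w hw =>
      hg w (hw.trans (Finset.le_sup (f := fun s => (l s).length) hs')))
    rw [hl3] at h1
    have h2 : (((l s).map (mE μ)).prod)⁻¹ ≤ 1 + ∑ s ∈ hS.1.toFinset, (((l s).map (mE μ)).prod)⁻¹ :=
      (Finset.single_le_sum (f := fun s => (((l s).map (mE μ)).prod)⁻¹) (fun _ _ => zero_le) hs').trans
        le_add_self
    calc (1 : ℝ≥0∞) = (((l s).map (mE μ)).prod)⁻¹ * ((l s).map (mE μ)).prod :=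
          (ENNReal.inv_mul_cancel (hP0 s) (hPT s)).symm
      _ ≤ _ := mul_le_mul' h2 h1

/-- Harnack comparison between two points -/
def Hk (μ : Γ → ℝ) (Δ : Set Γ) (M : ℝ≥0∞) (g g' : Γ) : Prop :=
  (∀ x, gE μ Δ x g ≤ M * gE μ Δ x g') ∧ (∀ y, gE μ Δ g' y ≤ M * gE μ Δ g y)

theorem Hk_refl (μ : Γ → ℝ) (Δ : Set Γ) (g : Γ) : Hk μ Δ 1 g g := by simp [Hk]

theorem Hk_trans {μ : Γ → ℝ} {Δ : Set Γ} {M M' : ℝ≥0∞} {g g' g'' : Γ} (h : Hk μ Δ M g g')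
    (h' : Hk μ Δ M' g' g'') : Hk μ Δ (M * M') g g'' := by
  constructor
  · intro x
    refine (h.1 x).trans ?_
    rw [mul_assoc]; gcongr; exact h'.1 x
  · intro y
    refine (h'.2 y).trans ?_
    rw [mul_comm M, mul_assoc]; gcongr; exact h.2 y

theorem Hk_mono {μ : Γ → ℝ} {Δ : Set Γ} {M M' : ℝ≥0∞} {g g' : Γ} (h : Hk μ Δ M g g')
    (hM : M ≤ M') : Hk μ Δ M' g g' :=
  ⟨fun x => (h.1 x).trans (by gcongr), fun x => (h.2 x).trans (by gcongr)⟩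

theorem harnack {S : Set Γ} {μ : Γ → ℝ} (hS : IsGenSet S) (hμ : IsRWMeasure S μ) :
    ∃ k : ℕ, ∃ K : ℝ≥0∞, 1 ≤ K ∧ K ≠ ⊤ ∧
      (∀ s ∈ S, ∀ (Δ : Set Γ) (g : Γ), g ∈ inn S k Δ → Hk μ Δ K g (g * s)) ∧
      (∀ (b : Γ) (Δ : Set Γ) (g : Γ), (∀ w, wl S w ≤ wl S b → g * w ∈ inn S k Δ) →
        Hk μ Δ (K ^ wl S b) g (g * b) ∧ Hk μ Δ (K ^ wl S b) (g * b) g) := by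
  obtain ⟨k, K, h1, h2, h3⟩ := harnack0 hS hμ
  have hs : ∀ s ∈ S, ∀ (Δ : Set Γ) (g : Γ), g ∈ inn S k Δ → Hk μ Δ K g (g * s) := by
    intro s hs Δ g hg
    obtain ⟨m, hm⟩ := h3 s hs Δ g hg
    constructor
    · intro x
      calc gE μ Δ x g ≤ gE μ Δ x g * (K * hE μ Δ m g (g * s)) := le_mul_of_one_le_right' hm
        _ = K * (gE μ Δ x g * hE μ Δ m g (g * s)) := by ring
        _ ≤ _ := by gcongr; exact gE_right _ _ _ _ _ _
    · intro y
      calc gE μ Δ (g * s) y ≤ (K * hE μ Δ m g (g * s)) * gE μ Δ (g * s) y := le_mul_of_one_le_left' hm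
        _ = K * (hE μ Δ m g (g * s) * gE μ Δ (g * s) y) := by ring
        _ ≤ _ := by gcongr; exact gE_left _ _ _ _ _ _
  refine ⟨k, K, h1, h2, hs, ?_⟩
  intro b Δ g hb
  obtain ⟨n, hn⟩ : ∃ n, n = wl S b := ⟨_, rfl⟩
  induction n generalizing b with
  | zero =>
    rw [eq_one_of_wl hS hn.symm]
    simp [wl_one, Hk_refl]
  | succ n ih =>
    obtain ⟨p, s, hp, hsS, rfl⟩ := wl_last hS b n hn.symm
    obtain ⟨i1, i2⟩ := ih p (fun w hw => hb w (by omega)) hp.symm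
    rw [hp] at i1 i2
    rw [← hn, ← mul_assoc]
    constructor
    · rw [pow_succ]
      exact Hk_trans i1 (hs s hsS Δ _ (hb p (by omega)))
    · rw [pow_succ']
      refine Hk_trans ?_ i2
      have := hs s⁻¹ (hS.2.1 s hsS) Δ (g * p * s) (by rw [mul_assoc]; exact hb _ le_rfl)
      rwa [mul_inv_cancel_right] at this

/-- excursion kernel -/
noncomputable def eE (μ : Γ → ℝ) (Ω : Set Γ) (q y : Γ) : ℝ≥0∞ :=
  sg q y + ∑' z, gE μ Ω q z * mE μ (z⁻¹ * y)

theorem decomp_aux (μ : Γ → ℝ) (Δ : Set Γ) {ι κ : Type} (a : ι → Γ) (b : κ → Γ) (i0 : ι) (n : ℕ)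
    (y : Γ) :
    ∑ k ∈ Finset.range (n + 1), hE μ Δ k (a i0) y ≤
      ∑' i, gE μ Δ (a i0) (a i) * gE μ (Δ \ (Set.range a ∪ Set.range b)) (a i) y +
      ∑' i, ∑' j, gE μ Δ (a i0) (a i) * eE μ (Δ \ (Set.range a ∪ Set.range b)) (a i) (b j) *
        gE μ Δ (b j) y := by
  classical
  obtain ⟨Ω, hΩ⟩ : ∃ Ω, Ω = Δ \ (Set.range a ∪ Set.range b) := ⟨_, rfl⟩
  rw [← hΩ]
  have hA : ∀ n i, ∑ k ∈ Finset.range (n + 1), hE μ Δ k (a i0) (a i) ≤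
      ∑' i', gE μ Δ (a i0) (a i') * gE μ Ω (a i') (a i) +
      ∑' i', ∑' j, gE μ Δ (a i0) (a i') * eE μ Ω (a i') (b j) * gE μ Δ (b j) (a i) := by
    intro n i
    refine (ENNReal.sum_le_tsum _).trans ?_
    refine le_trans ?_ le_self_add
    refine le_trans ?_ (ENNReal.le_tsum i)
    exact le_mul_of_one_le_right' (gE_self _ _ _)
  induction n generalizing y with
  | zero =>
    by_cases hy : y = a i0
    · subst hy; exact hA 0 i0
    · simp [hE, sg, hy]
  | succ n ih =>
    by_cases hya : y ∈ Set.range a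
    · obtain ⟨i, rfl⟩ := hya; exact hA _ i
    have hyx : y ≠ a i0 := fun h => hya ⟨i0, h.symm⟩
    rw [Finset.sum_range_succ']
    have h0 : hE μ Δ 0 (a i0) y = 0 := by simp [hE, sg, hyx]
    rw [h0, add_zero]
    by_cases hyΔ : y ∈ Δ
    swap
    · simp [hE, hyΔ]
    have h1 : ∑ k ∈ Finset.range (n + 1), hE μ Δ (k + 1) (a i0) y =
        ∑' z, (∑ k ∈ Finset.range (n + 1), hE μ Δ k (a i0) z) * mE μ (z⁻¹ * y) := by
      simp only [hE, hyΔ, if_true]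
      rw [← Summable.tsum_finsetSum (fun _ _ => ENNReal.summable)]
      exact tsum_congr fun z => by rw [Finset.sum_mul]
    rw [h1]
    have h2 : ∑' z, (∑ k ∈ Finset.range (n + 1), hE μ Δ k (a i0) z) * mE μ (z⁻¹ * y) ≤
        ∑' i, gE μ Δ (a i0) (a i) * (∑' z, gE μ Ω (a i) z * mE μ (z⁻¹ * y)) +
        ∑' i, ∑' j, gE μ Δ (a i0) (a i) * eE μ Ω (a i) (b j) *
          (∑' z, gE μ Δ (b j) z * mE μ (z⁻¹ * y)) := by
      refine (ENNReal.tsum_le_tsum fun z => mul_le_mul' (ih z) le_rfl).trans (le_of_eq ?_)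
      simp only [add_mul]
      rw [ENNReal.tsum_add]
      congr 1
      · simp only [← ENNReal.tsum_mul_right, ← ENNReal.tsum_mul_left]
        rw [ENNReal.tsum_comm]
        exact tsum_congr fun i => tsum_congr fun z => by ring
      · simp only [← ENNReal.tsum_mul_right, ← ENNReal.tsum_mul_left]
        rw [ENNReal.tsum_comm]
        refine tsum_congr fun i => ?_
        rw [ENNReal.tsum_comm]
        exact tsum_congr fun j => tsum_congr fun z => by ring
    refine h2.trans ?_
    by_cases hyb : y ∈ Set.range b
    · obtain ⟨j, rfl⟩ := hyb
      refine le_trans ?_ le_add_self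
      rw [← ENNReal.tsum_add]
      refine ENNReal.tsum_le_tsum fun i => ?_
      have h3 : gE μ Δ (a i0) (a i) * (∑' z, gE μ Ω (a i) z * mE μ (z⁻¹ * b j)) ≤
          ∑' j', gE μ Δ (a i0) (a i) * eE μ Ω (a i) (b j') * sg (b j') (b j) := by
        refine le_trans ?_ (ENNReal.le_tsum j)
        have : sg (b j) (b j) = 1 := by simp [sg]
        rw [this, mul_one]
        exact mul_le_mul' le_rfl le_add_self
      refine (add_le_add h3 le_rfl).trans (le_of_eq ?_)
      rw [← ENNReal.tsum_add]
      refine tsum_congr fun j' => ?_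
      rw [gE_eq μ Δ (b j') (b j) hyΔ, mul_add]
    · have hyO : y ∈ Ω := by
        rw [hΩ]; exact ⟨hyΔ, fun h => h.elim hya hyb⟩
      refine add_le_add (ENNReal.tsum_le_tsum fun i => ?_)
        (ENNReal.tsum_le_tsum fun i => ENNReal.tsum_le_tsum fun j => ?_)
      · rw [gE_eq μ Ω _ _ hyO]; exact mul_le_mul' le_rfl le_add_self
      · rw [gE_eq μ Δ _ _ hyΔ]; exact mul_le_mul' le_rfl le_add_self

theorem decomp (μ : Γ → ℝ) (Δ : Set Γ) {ι κ : Type} (a : ι → Γ) (b : κ → Γ) (i0 : ι) (j0 : κ) :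
    gE μ Δ (a i0) (b j0) ≤
      ∑' i, ∑' j, gE μ Δ (a i0) (a i) * eE μ (Δ \ (Set.range a ∪ Set.range b)) (a i) (b j) *
        gE μ Δ (b j) (b j0) := by
  classical
  by_cases h : b j0 ∈ Set.range a
  · obtain ⟨i, hi⟩ := h
    refine le_trans ?_ (ENNReal.le_tsum i)
    refine le_trans ?_ (ENNReal.le_tsum j0)
    rw [hi, mul_assoc]
    refine le_mul_of_one_le_right' (one_le_mul ?_ (gE_self _ _ _))
    refine le_trans ?_ le_self_add
    simp [sg]
  · have h1 : gE μ Δ (a i0) (b j0) ≤ _ :=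
      ENNReal.tsum_le_of_sum_range_le (fun n => le_trans
        (Finset.sum_le_sum_of_subset (Finset.range_mono (Nat.le_succ n)))
        (decomp_aux μ Δ a b i0 n (b j0)))
    refine h1.trans (le_of_eq ?_)
    have h2 : ∀ i, gE μ (Δ \ (Set.range a ∪ Set.range b)) (a i) (b j0) = 0 := by
      intro i
      rw [gE_out _ _ _ _ (by simp)]
      have : b j0 ≠ a i := fun e => h ⟨i, e.symm⟩
      simp [sg, this]
    simp [h2]

def IsProj (S : Set Γ) (L : ℕ) (α : ℕ → Γ) (p : Γ) (t : ℕ) : Prop :=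
  t ≤ L ∧ ∀ s ≤ L, wdist S p (α t) ≤ wdist S p (α s)

theorem exists_proj (S : Set Γ) (L : ℕ) (α : ℕ → Γ) (p : Γ) : ∃ t, IsProj S L α p t := by
  obtain ⟨t, ht, h⟩ := Finset.exists_min_image (Finset.range (L + 1)) (fun t => wdist S p (α t))
    ⟨0, by simp⟩
  refine ⟨t, by simpa [Nat.lt_succ_iff] using ht, fun s hs => h s (by simpa [Nat.lt_succ_iff] using hs)⟩

theorem triR {S : Set Γ} (hS : IsGenSet S) (x y z : Γ) :
    (wdist S x z : ℝ) ≤ wdist S x y + wdist S y z := by exact_mod_cast wdist_tri hS x y z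

theorem proj_dist {S : Set Γ} {δ : ℝ} (hS : IsGenSet S) (hδ : IsHyperbolic S δ) (L : ℕ)
    (α : ℕ → Γ) (hα : ∀ m n : ℕ, m ≤ L → n ≤ L → wdist S (α m) (α n) = Nat.dist m n)
    (p : Γ) (m t : ℕ) (hm : IsProj S L α p m) (ht : t ≤ L) :
    (wdist S p (α m) : ℝ) + wdist S (α m) (α t) - (4 * δ + 2) ≤ wdist S p (α t) := by
  have hδ0 := hδ.1
  obtain ⟨g, hg⟩ : ∃ g, g = gp S (α m) p (α t) := ⟨_, rfl⟩
  have hg' : g = ((wdist S p (α m) : ℝ) + wdist S (α m) (α t) - wdist S p (α t)) / 2 := by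
    rw [hg, gp, wdist_comm hS (α t)]
  have hg0 : 0 ≤ g := by
    have := triR hS p (α m) (α t); rw [hg']; linarith
  have hgl : g ≤ wdist S (α m) (α t) := by
    have := triR hS p (α t) (α m); rw [hg']; rw [wdist_comm hS (α t)] at this; linarith
  obtain ⟨s, hs⟩ : ∃ s, s = ⌊g⌋₊ := ⟨_, rfl⟩
  have hs1 : (s : ℝ) ≤ g := by rw [hs]; exact Nat.floor_le hg0
  have hs2 : g ≤ s + 1 := by rw [hs]; exact (Nat.lt_floor_add_one g).le
  have hsl : s ≤ Nat.dist m t := by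
    rw [← hα m t hm.1 ht]; exact_mod_cast hs1.trans hgl
  -- the point u
  obtain ⟨u, hu, hu1, hu2⟩ : ∃ u ≤ L, Nat.dist m u = s ∧ Nat.dist u t + s = Nat.dist m t := by
    rcases le_total m t with h | h
    · refine ⟨m + s, ?_, ?_, ?_⟩ <;> simp only [Nat.dist] at * <;> omega
    · have := hm.1
      refine ⟨m - s, ?_, ?_, ?_⟩ <;> simp only [Nat.dist] at * <;> omega
  rw [← hα m u hm.1 hu] at hu1
  rw [← hα m t hm.1 ht, ← hα u t hu ht] at hu2
  have hu1' : (wdist S (α m) (α u) : ℝ) = s := by exact_mod_cast hu1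
  have hu2' : (wdist S (α u) (α t) : ℝ) + s = wdist S (α m) (α t) := by exact_mod_cast hu2
  have hh := hyp_base hδ (α m) p (α u) (α t)
  have e1 : gp S (α m) (α u) (α t) = s := by
    rw [gp, wdist_comm hS (α u) (α m), wdist_comm hS (α t) (α m)]; linarith
  rw [← hg, e1, min_eq_right hs1] at hh
  rw [gp, wdist_comm hS (α u) (α m), hu1'] at hh
  have hmin : (wdist S p (α m) : ℝ) ≤ wdist S p (α u) := by exact_mod_cast hm.2 u hu
  have : g ≤ 2 * δ + 1 := by linarith
  rw [hg'] at this
  linarith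

theorem proj_lip {S : Set Γ} {δ : ℝ} (hS : IsGenSet S) (hδ : IsHyperbolic S δ) (L : ℕ)
    (α : ℕ → Γ) (hα : ∀ m n : ℕ, m ≤ L → n ≤ L → wdist S (α m) (α n) = Nat.dist m n)
    (C r : ℕ) (hC : 5 * δ + 2 ≤ C) (hr : C ≤ r) (p p' : Γ) (t t' : ℕ) (ht : IsProj S L α p t)
    (ht' : IsProj S L α p' t') (hp : ∀ i ≤ L, r < wdist S p (α i))
    (hp' : ∀ i ≤ L, r < wdist S p' (α i)) (hd : wdist S p p' ≤ r) : wdist S (α t) (α t') ≤ C := by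
  have hδ0 := hδ.1
  have h1 := proj_dist hS hδ L α hα p t t' ht ht'.1
  have h2 := proj_dist hS hδ L α hα p' t' t ht' ht.1
  rw [wdist_comm hS (α t') (α t)] at h2
  have hD : (r : ℝ) ≤ wdist S p (α t) := by exact_mod_cast (hp t ht.1).le
  have hD' : (r : ℝ) ≤ wdist S p' (α t') := by exact_mod_cast (hp' t' ht'.1).le
  have hdR : (wdist S p p' : ℝ) ≤ r := by exact_mod_cast hd
  have hrR : (C : ℝ) ≤ r := by exact_mod_cast hr
  have h4 := hyp_base hδ (α t) p (α t') p'
  have key : (wdist S (α t) (α t') : ℝ) ≤ C := by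
    have e : wdist S (α t') p' = wdist S p' (α t') := wdist_comm hS _ _
    have e' : wdist S (α t') (α t) = wdist S (α t) (α t') := wdist_comm hS _ _
    simp only [gp, e, e'] at h4
    rcases min_choice (((wdist S p (α t) : ℝ) + wdist S p' (α t) - wdist S p p') / 2)
      (((wdist S (α t) (α t') : ℝ) + wdist S p' (α t) - wdist S p' (α t')) / 2) with h | h
    · rw [h] at h4; linarith
    · rw [h] at h4; linarith
  exact_mod_cast key

theorem hE_step (μ : Γ → ℝ) (Ω : Set Γ) (n : ℕ) (q z : Γ) (h : hE μ Ω (n + 1) q z ≠ 0) :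
    z ∈ Ω ∧ ∃ z', hE μ Ω n q z' ≠ 0 ∧ mE μ (z'⁻¹ * z) ≠ 0 := by
  simp only [hE] at h
  split_ifs at h with hz
  · refine ⟨hz, ?_⟩
    by_contra hcon
    push Not at hcon
    apply h
    rw [ENNReal.tsum_eq_zero]
    intro z'
    by_cases h' : hE μ Ω n q z' = 0
    · rw [h', zero_mul]
    · rw [hcon z' h', mul_zero]
  · exact absurd rfl h

theorem mE_dist {S : Set Γ} {μ : Γ → ℝ} (hμ : IsRWMeasure S μ) {z z' : Γ}
    (h : mE μ (z⁻¹ * z') ≠ 0) : wdist S z z' ≤ 1 := by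
  refine wl_gen (hμ.support_subset _ fun e => h ?_)
  simp [mE, e]

theorem hE_back {S : Set Γ} {μ : Γ → ℝ} (hS : IsGenSet S) (hμ : IsRWMeasure S μ) (Ω : Set Γ)
    (m k : ℕ) (q z : Γ) (h : hE μ Ω (m + k) q z ≠ 0) :
    ∃ z', hE μ Ω m q z' ≠ 0 ∧ wdist S z' z ≤ k := by
  induction k generalizing z with
  | zero => exact ⟨z, h, by rw [wdist_self]⟩
  | succ k ih =>
    obtain ⟨-, z1, h1, h2⟩ := hE_step μ Ω (m + k) q z h
    obtain ⟨z', h3, h4⟩ := ih z1 h1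
    have := wdist_tri hS z' z1 z
    have := mE_dist hμ h2
    exact ⟨z', h3, by omega⟩

theorem hE_dist {S : Set Γ} {μ : Γ → ℝ} (hS : IsGenSet S) (hμ : IsRWMeasure S μ) (Ω : Set Γ)
    (k : ℕ) (q z : Γ) (h : hE μ Ω k q z ≠ 0) : wdist S q z ≤ k := by
  obtain ⟨z', h1, h2⟩ := hE_back hS hμ Ω 0 k q z (by rwa [Nat.zero_add])
  have : z' = q := by
    by_contra hne
    exact h1 (by simp [hE, sg, hne])
  rwa [this] at h2

theorem proj_near {S : Set Γ} (hS : IsGenSet S) {L : ℕ} {α : ℕ → Γ} {z : Γ} {t i c : ℕ}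
    (ht : IsProj S L α z t) (hi : i ≤ L) (h : wdist S z (α i) ≤ c) :
    wdist S (α i) (α t) ≤ 2 * c := by
  have h1 := ht.2 i hi
  have h2 := wdist_tri hS (α i) z (α t)
  rw [wdist_comm hS (α i) z] at h2
  omega

theorem hE_proj {S : Set Γ} {δ : ℝ} (hS : IsGenSet S) (hδ : IsHyperbolic S δ) {μ : Γ → ℝ}
    (hμ : IsRWMeasure S μ) (L : ℕ)
    (α : ℕ → Γ) (hα : ∀ m n : ℕ, m ≤ L → n ≤ L → wdist S (α m) (α n) = Nat.dist m n)
    (C r : ℕ) (hC : 5 * δ + 2 ≤ C) (hr : C ≤ r) (hr0 : 0 < r) (Ω : Set Γ)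
    (hΩ : ∀ z ∈ Ω, ∀ i ≤ L, r < wdist S z (α i)) (q : Γ) (i : ℕ) (hi : i ≤ L)
    (hq : wdist S q (α i) ≤ r) (n : ℕ) (z : Γ) (t : ℕ) (ht : IsProj S L α z t)
    (h : hE μ Ω n q z ≠ 0) : wdist S (α i) (α t) ≤ 4 * r + C * (n / r) := by
  induction n using Nat.strong_induction_on generalizing z t with
  | _ n ih =>
  rcases le_or_gt n r with hn | hn
  · have h1 := hE_dist hS hμ Ω n q z h
    have h2 := wdist_tri hS z q (α i)
    rw [wdist_comm hS z q] at h2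
    have := proj_near hS ht hi (c := 2 * r) (by omega)
    omega
  · obtain ⟨m, rfl⟩ : ∃ m, n = (m + 1) + r := ⟨n - r - 1, by omega⟩
    obtain ⟨z', h1, h2⟩ := hE_back hS hμ Ω (m + 1) r q z h
    obtain ⟨t', ht'⟩ := exists_proj S L α z'
    have h3 := ih (m + 1) (by omega) z' t' ht' h1
    have hz' := (hE_step μ Ω m q z' h1).1
    have hz := (hE_step μ Ω (m + r) q z (by rwa [show m + r + 1 = m + 1 + r by ring])).1
    have h4 := proj_lip hS hδ L α hα C r hC hr z' z t' t ht' ht (hΩ _ hz') (hΩ _ hz) h2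
    have h5 := wdist_tri hS (α i) (α t') (α t)
    rw [Nat.add_div_right _ hr0, Nat.mul_add]
    omega

theorem hE_support {S : Set Γ} {δ : ℝ} (hS : IsGenSet S) (hδ : IsHyperbolic S δ) {μ : Γ → ℝ}
    (hμ : IsRWMeasure S μ) (L : ℕ)
    (α : ℕ → Γ) (hα : ∀ m n : ℕ, m ≤ L → n ≤ L → wdist S (α m) (α n) = Nat.dist m n)
    (C r : ℕ) (hC : 5 * δ + 2 ≤ C) (hr : C ≤ r) (hr0 : 0 < r) (Ω : Set Γ)
    (hΩ : ∀ z ∈ Ω, ∀ i ≤ L, r < wdist S z (α i)) (q q' : Γ) (i j : ℕ) (hi : i ≤ L) (hj : j ≤ L)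
    (hq : wdist S q (α i) ≤ r) (hq' : wdist S q' (α j) ≤ r) (n : ℕ) (z : Γ)
    (h : hE μ Ω n q z ≠ 0) (hz : wdist S z q' ≤ 1) :
    Nat.dist i j ≤ 6 * r + 2 + C * (n / r) := by
  obtain ⟨t, ht⟩ := exists_proj S L α z
  have h1 := hE_proj hS hδ hμ L α hα C r hC hr hr0 Ω hΩ q i hi hq n z t ht h
  have h2 := proj_near hS ht hj (c := r + 1) (by
    have := wdist_tri hS z q' (α j); omega)
  rw [← hα i j hi hj]
  have h3 := wdist_tri hS (α i) (α t) (α j)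
  rw [wdist_comm hS (α t)] at h3
  omega

theorem decayE {S : Set Γ} {δ : ℝ} (hS : IsGenSet S) (hδ : IsHyperbolic S δ)
    (hne : Nonelementary Γ) {μ : Γ → ℝ} (hμ : IsRWMeasure S μ) :
    ∃ A l : ℝ≥0∞, A ≠ ⊤ ∧ l < 1 ∧ ∀ (n : ℕ) (x y : Γ), Wn (mE μ) n (x⁻¹ * y) ≤ A * (l ^ n * l ^ n) := by
  obtain ⟨C, l, hC, hl0, hl1, h⟩ := decay hS hδ hne hμ
  refine ⟨ENNReal.ofReal C, ENNReal.ofReal (√l), ENNReal.ofReal_ne_top, ?_, fun n x y => ?_⟩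
  · rw [← ENNReal.ofReal_one]
    refine (ENNReal.ofReal_lt_ofReal_iff one_pos).2 ?_
    rw [Real.sqrt_lt' one_pos]; simpa using hl1
  · rw [← Wn_eq]
    refine (h n y x).trans (le_of_eq ?_)
    rw [← mul_pow, ← ENNReal.ofReal_mul (Real.sqrt_nonneg l), Real.mul_self_sqrt hl0.le,
      ENNReal.ofReal_mul hC.le, ENNReal.ofReal_pow hl0.le]

theorem exists_r (l κ : ℝ≥0∞) (hl : l < 1) (hκ : κ ≠ ⊤) (C1 : ℕ) :
    ∃ r : ℕ, 0 < r ∧ C1 ≤ r ∧ l ^ r ≤ κ⁻¹ ^ C1 := by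
  have h1 : Tendsto (fun n : ℕ => l ^ n) atTop (𝓝 0) := ENNReal.tendsto_pow_atTop_nhds_zero_of_lt_one hl
  have h2 : (0 : ℝ≥0∞) < κ⁻¹ ^ C1 := by
    refine pos_iff_ne_zero.2 (pow_ne_zero _ ?_)
    simpa using hκ
  obtain ⟨r, h3, h4⟩ := ((h1.eventually (gt_mem_nhds h2)).and (eventually_ge_atTop (C1 + 1))).exists
  exact ⟨r, by omega, by omega, h3.le⟩

theorem eE_bound {S : Set Γ} {δ : ℝ} (hS : IsGenSet S) (hδ : IsHyperbolic S δ)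
    (hne : Nonelementary Γ) {μ : Γ → ℝ} (hμ : IsRWMeasure S μ) (κ : ℝ≥0∞) (h1 : 1 ≤ κ)
    (hκ : κ ≠ ⊤) : ∃ (r : ℕ) (M : ℝ≥0∞), 0 < r ∧ M ≠ ⊤ ∧
    ∀ (L : ℕ) (α : ℕ → Γ) (_ : ∀ m n : ℕ, m ≤ L → n ≤ L → wdist S (α m) (α n) = Nat.dist m n)
      (Ω : Set Γ) (_ : ∀ z ∈ Ω, ∀ i ≤ L, r < wdist S z (α i)) (q q' : Γ) (i j : ℕ)
      (_ : i ≤ L) (_ : j ≤ L) (_ : wdist S q (α i) ≤ r) (_ : wdist S q' (α j) ≤ r),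
      eE μ Ω q q' ≤ M * κ⁻¹ ^ (Nat.dist i j) := by
  obtain ⟨A, l, hA, hl, hW⟩ := decayE hS hδ hne hμ
  obtain ⟨C1, hC1⟩ := exists_nat_ge (5 * δ + 2)
  obtain ⟨r, hr0, hr1, hr2⟩ := exists_r l κ hl hκ C1
  have hi1 : κ⁻¹ ≤ 1 := ENNReal.inv_le_one.2 h1
  have h0 : κ ≠ 0 := (zero_lt_one.trans_le h1).ne'
  have hcan : ∀ m : ℕ, κ⁻¹ ^ m * κ ^ m = 1 := fun m => by
    rw [← mul_pow, ENNReal.inv_mul_cancel h0 hκ, one_pow]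
  refine ⟨r, κ ^ (6 * r + 2) * (1 + A * (1 - l)⁻¹), hr0, ?_, ?_⟩
  · refine ENNReal.mul_ne_top (ENNReal.pow_ne_top hκ) (ENNReal.add_ne_top.2 ⟨by simp, ?_⟩)
    refine ENNReal.mul_ne_top hA ?_
    simpa [tsub_eq_zero_iff_le] using hl
  intro L α hα Ω hΩ q q' i j hi hj hq hq'
  set D := Nat.dist i j with hD
  have key : ∀ N, D ≤ 6 * r + 2 + N → κ⁻¹ ^ N ≤ κ ^ (6 * r + 2) * κ⁻¹ ^ D := by
    intro N hN
    calc κ⁻¹ ^ N = κ ^ (6 * r + 2) * κ⁻¹ ^ (6 * r + 2 + N) := by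
          rw [pow_add κ⁻¹ (6 * r + 2) N, ← mul_assoc, mul_comm (κ ^ _), hcan, one_mul]
      _ ≤ _ := by gcongr 1; exact pow_le_pow_right_of_le_one' hi1 hN
  have hsg : sg q q' ≤ κ ^ (6 * r + 2) * κ⁻¹ ^ D := by
    unfold sg
    split_ifs with h
    · subst h
      have := key 0 ?_
      · simpa using this
      · have h2 := wdist_tri hS (α i) q' (α j)
        rw [hα i j hi hj, wdist_comm hS (α i)] at h2
        omega
    · simp
  have hT : ∀ n, ∑' z, hE μ Ω n q z * mE μ (z⁻¹ * q') ≤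
      κ ^ (6 * r + 2) * κ⁻¹ ^ D * A * l ^ n := by
    intro n
    by_cases hz : ∑' z, hE μ Ω n q z * mE μ (z⁻¹ * q') = 0
    · rw [hz]; exact zero_le
    have hn : D ≤ 6 * r + 2 + C1 * (n / r) := by
      rw [ENNReal.tsum_eq_zero] at hz
      push Not at hz
      obtain ⟨z, hz⟩ := hz
      exact hE_support hS hδ hμ L α hα C1 r hC1 hr1 hr0 Ω hΩ q q' i j hi hj hq hq' n z
        (left_ne_zero_of_mul hz) (mE_dist hμ (right_ne_zero_of_mul hz))
    have hln : l ^ n ≤ κ ^ (6 * r + 2) * κ⁻¹ ^ D := by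
      refine le_trans ?_ (key _ hn)
      calc l ^ n ≤ l ^ (r * (n / r)) := pow_le_pow_right_of_le_one' hl.le (Nat.mul_div_le n r)
        _ = (l ^ r) ^ (n / r) := pow_mul _ _ _
        _ ≤ (κ⁻¹ ^ C1) ^ (n / r) := by gcongr
        _ = _ := (pow_mul _ _ _).symm
    calc ∑' z, hE μ Ω n q z * mE μ (z⁻¹ * q')
        ≤ ∑' z, Wn (mE μ) n (q⁻¹ * z) * mE μ (z⁻¹ * q') :=
          ENNReal.tsum_le_tsum fun z => by gcongr; exact hE_le_Wn μ Ω n q z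
      _ = Wn (mE μ) (n + 1) (q⁻¹ * q') := (Wn_right _ _ _ _).symm
      _ ≤ A * (l ^ (n + 1) * l ^ (n + 1)) := hW _ _ _
      _ ≤ A * (l ^ n * l ^ n) := by
          have : l ^ (n + 1) ≤ l ^ n := pow_le_pow_right_of_le_one' hl.le (Nat.le_succ n)
          gcongr
      _ ≤ A * ((κ ^ (6 * r + 2) * κ⁻¹ ^ D) * l ^ n) := by gcongr
      _ = _ := by ring
  have he : eE μ Ω q q' = sg q q' + ∑' n, ∑' z, hE μ Ω n q z * mE μ (z⁻¹ * q') := by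
    unfold eE gE
    rw [sum_tsum_comm]
  rw [he]
  calc _ ≤ κ ^ (6 * r + 2) * κ⁻¹ ^ D + ∑' n, κ ^ (6 * r + 2) * κ⁻¹ ^ D * A * l ^ n :=
        add_le_add hsg (ENNReal.tsum_le_tsum hT)
    _ = _ := by rw [ENNReal.tsum_mul_left, ENNReal.tsum_geometric]; ring

theorem gE_bound {S : Set Γ} {δ : ℝ} (hS : IsGenSet S) (hδ : IsHyperbolic S δ)
    (hne : Nonelementary Γ) {μ : Γ → ℝ} (hμ : IsRWMeasure S μ) : ∃ B : ℝ≥0∞, B ≠ ⊤ ∧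
    ∀ Ω x y, gE μ Ω x y ≤ B := by
  obtain ⟨A, l, hA, hl, hW⟩ := decayE hS hδ hne hμ
  refine ⟨A * (1 - l)⁻¹, ?_, fun Ω x y => ?_⟩
  · refine ENNReal.mul_ne_top hA ?_
    simpa [tsub_eq_zero_iff_le] using hl
  · rw [← ENNReal.tsum_geometric, ← ENNReal.tsum_mul_left]
    refine ENNReal.tsum_le_tsum fun n => (hE_le_Wn μ Ω n x y).trans ((hW n x y).trans ?_)
    gcongr
    exact mul_le_of_le_one_left' (pow_le_one' hl.le n)

theorem ancona {S : Set Γ} {δ : ℝ} (hS : IsGenSet S) (hδ : IsHyperbolic S δ)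
    (hne : Nonelementary Γ) {μ : Γ → ℝ} (hμ : IsRWMeasure S μ) :
    ∃ (k r : ℕ) (K C : ℝ≥0∞), 0 < r ∧ 1 ≤ K ∧ K ≠ ⊤ ∧ C ≠ ⊤ ∧
    (∀ (b : Γ) (Δ : Set Γ) (g : Γ), (∀ w, wl S w ≤ wl S b → g * w ∈ inn S k Δ) →
        Hk μ Δ (K ^ wl S b) g (g * b) ∧ Hk μ Δ (K ^ wl S b) (g * b) g) ∧
    ∀ (L : ℕ) (α : ℕ → Γ) (_ : ∀ m n : ℕ, m ≤ L → n ≤ L → wdist S (α m) (α n) = Nat.dist m n)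
      (Δ : Set Γ) (_ : ∀ i ≤ L, ∀ w, wl S w ≤ r → α i * w ∈ inn S k Δ) (i0 : ℕ) (_ : i0 ≤ L),
      gE μ Δ (α 0) (α L) ≤ C * (gE μ Δ (α 0) (α i0) * gE μ Δ (α i0) (α L)) := by
  obtain ⟨k, K, hK1, hKT, hstep, hb⟩ := harnack hS hμ
  have hK0 : K ≠ 0 := (zero_lt_one.trans_le hK1).ne'
  obtain ⟨r, M, hr, hM, hE⟩ := eE_bound hS hδ hne hμ (2 * K)
    (hK1.trans (le_mul_of_one_le_left' (by norm_num))) (ENNReal.mul_ne_top (by norm_num) hKT)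
  set N : ℝ≥0∞ := ((ballF hS r).card : ℝ≥0∞) with hN
  refine ⟨k, r, K, M * K ^ r * K ^ r * (N * N) * (2 * 2), hr, hK1, hKT, ?_, hb, ?_⟩
  · have := ENNReal.pow_ne_top (n := r) hKT
    have : N ≠ ⊤ := ENNReal.natCast_ne_top _
    finiteness
  intro L α hα Δ hΔ i0 hi0
  have hgeo : ∀ m i, i + m ≤ L → Hk μ Δ (K ^ m) (α i) (α (i + m)) := by
    intro m
    induction m with
    | zero => intro i _; simpa using Hk_refl μ Δ (α i)
    | succ m ih =>
      intro i hi
      rw [pow_succ]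
      refine Hk_trans (ih i (by omega)) ?_
      have h1 : wl S ((α (i + m))⁻¹ * α (i + m + 1)) = 1 := by
        have := hα (i + m) (i + m + 1) (by omega) (by omega)
        unfold wdist at this
        rw [this]; simp [Nat.dist]
      have h2 := hstep _ (mem_of_wl_one hS h1) Δ (α (i + m)) (by
        simpa using hΔ (i + m) (by omega) 1 (by simp [wl_one]))
      rwa [mul_inv_cancel_left] at h2
  have hbr : ∀ i ≤ L, ∀ w, wl S w ≤ r → Hk μ Δ (K ^ r) (α i) (α i * w) ∧
      Hk μ Δ (K ^ r) (α i * w) (α i) := by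
    intro i hi w hw
    have h := hb w Δ (α i) (fun w' hw' => hΔ i hi w' (hw'.trans hw))
    have h2 : K ^ wl S w ≤ K ^ r := pow_le_pow_right' hK1 hw
    exact ⟨Hk_mono h.1 h2, Hk_mono h.2 h2⟩
  let a : Fin (i0 + 1) × ballF hS r → Γ := fun p => α (i0 - p.1) * p.2
  let b : Fin (L - i0 + 1) × ballF hS r → Γ := fun p => α (i0 + p.1) * p.2
  have h1m : wl S (1 : Γ) ≤ r := by simp [wl_one]
  have hdec := decomp μ Δ a b (⟨i0, by omega⟩, ⟨1, one_mem_ballF hS r⟩)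
    (⟨L - i0, by omega⟩, ⟨1, one_mem_ballF hS r⟩)
  have ha0 : a (⟨i0, by omega⟩, ⟨1, one_mem_ballF hS r⟩) = α 0 := by simp [a]
  have hb0 : b (⟨L - i0, by omega⟩, ⟨1, one_mem_ballF hS r⟩) = α L := by
    simp only [b, mul_one]
    congr 1
    omega
  rw [ha0, hb0] at hdec
  have hΩ : ∀ z ∈ Δ \ (Set.range a ∪ Set.range b), ∀ i ≤ L, r < wdist S z (α i) := by
    intro z hz i hi
    by_contra hlt
    push Not at hlt
    apply hz.2
    have hw : wl S ((α i)⁻¹ * z) ≤ r := by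
      rw [wdist_comm hS] at hlt; exact hlt
    rcases le_total i i0 with h | h
    · left
      refine ⟨(⟨i0 - i, by omega⟩, ⟨(α i)⁻¹ * z, (mem_ballF hS).2 hw⟩), ?_⟩
      simp only [a]
      rw [show i0 - (i0 - i) = i by omega, mul_inv_cancel_left]
    · right
      refine ⟨(⟨i - i0, by omega⟩, ⟨(α i)⁻¹ * z, (mem_ballF hS).2 hw⟩), ?_⟩
      simp only [b]
      rw [show i0 + (i - i0) = i by omega, mul_inv_cancel_left]
  set X := gE μ Δ (α 0) (α i0) with hX
  set Y := gE μ Δ (α i0) (α L) with hY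
  have hKc : ∀ m : ℕ, K ^ m * (2 * K)⁻¹ ^ m = 2⁻¹ ^ m := by
    intro m
    rw [← mul_pow, ENNReal.mul_inv (by simp) (by simp), mul_comm (2⁻¹ : ℝ≥0∞), ← mul_assoc,
      ENNReal.mul_inv_cancel hK0 hKT, one_mul]
  have hterm : ∀ p q, gE μ Δ (α 0) (a p) * eE μ (Δ \ (Set.range a ∪ Set.range b)) (a p) (b q) *
      gE μ Δ (b q) (α L) ≤ (M * K ^ r * K ^ r * (X * Y)) * 
        (2⁻¹ ^ (p.1 : ℕ) * 2⁻¹ ^ (q.1 : ℕ)) := by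
    rintro ⟨s, w⟩ ⟨t, w'⟩
    have hs := s.2
    have ht := t.2
    have hw := (mem_ballF hS).1 w.2
    have hw' := (mem_ballF hS).1 w'.2
    have e1 : gE μ Δ (α 0) (a (s, w)) ≤ K ^ r * (K ^ (s : ℕ) * X) := by
      refine ((hbr (i0 - s) (by omega) w hw).2.1 (α 0)).trans ?_
      gcongr
      have := (hgeo s (i0 - s) (by omega)).1 (α 0)
      rwa [show i0 - (s : ℕ) + s = i0 by omega] at this
    have e2 : gE μ Δ (b (t, w')) (α L) ≤ K ^ r * (K ^ (t : ℕ) * Y) := by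
      refine ((hbr (i0 + t) (by omega) w' hw').1.2 (α L)).trans ?_
      gcongr
      exact (hgeo t i0 (by omega)).2 (α L)
    have e3 := hE L α hα _ hΩ (a (s, w)) (b (t, w')) (i0 - s) (i0 + t) (by omega) (by omega)
      (by rw [wdist_comm hS]; simp only [a]; rwa [wdist_mul])
      (by rw [wdist_comm hS]; simp only [b]; rwa [wdist_mul])
    have hd : Nat.dist (i0 - s) (i0 + t) = s + t := by unfold Nat.dist; omega
    rw [hd] at e3
    calc _ ≤ K ^ r * (K ^ (s : ℕ) * X) * (M * (2 * K)⁻¹ ^ ((s : ℕ) + t)) * 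
          (K ^ r * (K ^ (t : ℕ) * Y)) := by gcongr
      _ = (M * K ^ r * K ^ r * (X * Y)) * ((K ^ (s : ℕ) * (2 * K)⁻¹ ^ (s : ℕ)) * 
          (K ^ (t : ℕ) * (2 * K)⁻¹ ^ (t : ℕ))) := by rw [pow_add]; ring
      _ = _ := by rw [hKc, hKc]
  have hsum : ∀ n : ℕ, ∑' p : Fin n × ballF hS r, (2⁻¹ : ℝ≥0∞) ^ (p.1 : ℕ) ≤ N * 2 := by
    intro n
    rw [ENNReal.tsum_prod']
    simp only [tsum_fintype, Finset.sum_const, Finset.card_univ, Fintype.card_coe, nsmul_eq_mul]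
    rw [← Finset.mul_sum]
    gcongr
    rw [← tsum_fintype (L := SummationFilter.unconditional _)]
    refine (ENNReal.tsum_comp_le_tsum_of_injective Fin.val_injective
      (fun n : ℕ => (2⁻¹ : ℝ≥0∞) ^ n)).trans (le_of_eq ?_)
    rw [ENNReal.tsum_geometric, ENNReal.one_sub_inv_two, inv_inv]
  refine hdec.trans ((ENNReal.tsum_le_tsum fun p => ENNReal.tsum_le_tsum fun q => hterm p q).trans ?_)
  simp only [ENNReal.tsum_mul_left, ENNReal.tsum_mul_right]
  calc _ ≤ M * K ^ r * K ^ r * (X * Y) * ((N * 2) * (N * 2)) := by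
        gcongr
        · exact hsum _
        · exact hsum _
    _ = _ := by ring

theorem ptransR_eq {S : Set Γ} {δ : ℝ} (hS : IsGenSet S) (hδ : IsHyperbolic S δ)
    (hne : Nonelementary Γ) {μ : Γ → ℝ} (hμ : IsRWMeasure S μ) (Δ : Set Γ) (x : Γ) (hx : x ∈ Δ)
    (n : ℕ) (y : Γ) : ptransR μ Δ n x y = (hE μ Δ n x y).toReal := by
  obtain ⟨A, l, hA, hl, hW⟩ := decayE hS hδ hne hμ
  have hWT : ∀ n (x y : Γ), Wn (mE μ) n (x⁻¹ * y) ≠ ⊤ := fun n x y =>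
    ne_top_of_le_ne_top (by have := hl.ne_top; finiteness) (hW n x y)
  induction n generalizing y with
  | zero =>
    simp only [ptransR, hE, sg, hx, and_true]
    by_cases h : x = y
    · subst h; simp [hx]
    · simp [h, Ne.symm h]
  | succ n ih =>
    simp only [ptransR, hE]
    split_ifs with h
    · have hT : ∑' z, hE μ Δ n x z * mE μ (z⁻¹ * y) ≠ ⊤ := by
        refine ne_top_of_le_ne_top (hWT (n + 1) x y) ?_
        rw [Wn_right]
        exact ENNReal.tsum_le_tsum fun z => by gcongr; exact hE_le_Wn μ Δ n x z
      rw [ENNReal.tsum_toReal_eq (fun z => ENNReal.ne_top_of_tsum_ne_top hT z)]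
      refine tsum_congr fun z => ?_
      rw [ENNReal.toReal_mul, ih, mE, ENNReal.toReal_ofReal (hμ.nonneg _)]
    · simp

theorem greenR_eq {S : Set Γ} {δ : ℝ} (hS : IsGenSet S) (hδ : IsHyperbolic S δ)
    (hne : Nonelementary Γ) {μ : Γ → ℝ} (hμ : IsRWMeasure S μ) (Δ : Set Γ) (x : Γ) (hx : x ∈ Δ)
    (y : Γ) : greenR μ Δ x y = (gE μ Δ x y).toReal := by
  obtain ⟨B, hB, h⟩ := gE_bound hS hδ hne hμ
  have hT : gE μ Δ x y ≠ ⊤ := ne_top_of_le_ne_top hB (h Δ x y)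
  unfold greenR gE
  rw [ENNReal.tsum_toReal_eq (fun z => ENNReal.ne_top_of_tsum_ne_top hT z)]
  exact tsum_congr fun n => ptransR_eq hS hδ hne hμ Δ x hx n y

theorem green_conv {S : Set Γ} {δ : ℝ} (hS : IsGenSet S) (hδ : IsHyperbolic S δ)
    (hne : Nonelementary Γ) {μ : Γ → ℝ} (hμ : IsRWMeasure S μ) (C : ℝ≥0∞) (hC : C ≠ ⊤) :
    ∃ C' : ℝ, 1 ≤ C' ∧ ∀ (Δ : Set Γ) (x y v : Γ), x ∈ Δ → v ∈ Δ →
      gE μ Δ x y ≤ C * (gE μ Δ x v * gE μ Δ v y) →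
      greenR μ Δ x y ≤ C' * greenFR μ Δ x v * greenR μ Δ v y := by
  obtain ⟨B, hB, h⟩ := gE_bound hS hδ hne hμ
  refine ⟨max 1 (C.toReal * B.toReal), le_max_left _ _, fun Δ x y v hx hv hle => ?_⟩
  have hT : ∀ x y, gE μ Δ x y ≠ ⊤ := fun x y => ne_top_of_le_ne_top hB (h Δ x y)
  have h1 := ENNReal.toReal_mono (by have := hT x v; have := hT v y; finiteness) hle
  simp only [ENNReal.toReal_mul] at h1
  unfold greenFR
  rw [greenR_eq hS hδ hne hμ Δ x hx, greenR_eq hS hδ hne hμ Δ x hx,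
    greenR_eq hS hδ hne hμ Δ v hv, greenR_eq hS hδ hne hμ Δ v hv]
  have hg1 : 1 ≤ (gE μ Δ v v).toReal := by
    simpa using ENNReal.toReal_mono (hT v v) (gE_self μ Δ v)
  have hg2 : (gE μ Δ v v).toReal ≤ B.toReal := ENNReal.toReal_mono hB (h Δ v v)
  have hg3 : 0 < (gE μ Δ v v).toReal := by linarith
  have hxv : 0 ≤ (gE μ Δ x v).toReal := ENNReal.toReal_nonneg
  have hvy : 0 ≤ (gE μ Δ v y).toReal := ENNReal.toReal_nonneg
  have hCn : 0 ≤ C.toReal := ENNReal.toReal_nonneg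
  refine h1.trans ?_
  rw [← mul_assoc]
  refine mul_le_mul_of_nonneg_right ?_ hvy
  calc C.toReal * (gE μ Δ x v).toReal
      = (C.toReal * (gE μ Δ v v).toReal) * ((gE μ Δ x v).toReal / (gE μ Δ v v).toReal) := by
        field_simp
    _ ≤ (C.toReal * B.toReal) * ((gE μ Δ x v).toReal / (gE μ Δ v v).toReal) := by gcongr
    _ ≤ _ := by gcongr; exact le_max_right _ _

theorem main_aux {S : Set Γ} {δ : ℝ} (hS : IsGenSet S) (hδ : IsHyperbolic S δ)
    (hne : Nonelementary Γ) {μ : Γ → ℝ} (hμ : IsRWMeasure S μ) :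
    ∃ R0 : ℝ, 0 < R0 ∧ ∀ R1 : ℝ, 0 ≤ R1 → ∃ C' : ℝ, 1 ≤ C' ∧
        ∀ (x y v : Γ) (α : ℕ → Γ) (Δ : Set Γ), IsGeodesicSeg S x y α →
          v ∈ segN S x y α R1 → segN S x y α (R0 + R1) ⊆ Δ →
          greenR μ Δ x y ≤ C' * greenFR μ Δ x v * greenR μ Δ v y := by
  obtain ⟨k, r, K, C, hr, hK1, hKT, hC, hb, hmain⟩ := ancona hS hδ hne hμ
  have hr' : (0 : ℝ) < r := by exact_mod_cast hr
  refine ⟨(r + k : ℝ), by positivity, fun R1 hR1 => ?_⟩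
  obtain ⟨C', hC', hconv⟩ := green_conv hS hδ hne hμ (C * (K ^ ⌊R1⌋₊ * K ^ ⌊R1⌋₊))
    (by have := ENNReal.pow_ne_top (n := ⌊R1⌋₊) hKT; finiteness)
  refine ⟨C', hC', fun x y v α Δ ⟨h0, hL, hα⟩ hv hΔ => ?_⟩
  obtain ⟨i0, hi0, hvi⟩ := hv
  have hvf : wdist S v (α i0) ≤ ⌊R1⌋₊ := Nat.le_floor hvi
  have hin : ∀ i ≤ wdist S x y, ∀ w, (wl S w : ℝ) ≤ r + R1 → α i * w ∈ inn S k Δ := by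
    intro i hi w hw w' hw'
    apply hΔ
    refine ⟨i, hi, ?_⟩
    rw [wdist_comm hS, mul_assoc, wdist_mul]
    have h1 : (wl S (w * w') : ℝ) ≤ wl S w + wl S w' := by exact_mod_cast wl_mul_le hS w w'
    have h2 : (wl S w' : ℝ) ≤ k := by exact_mod_cast hw'
    linarith
  have hk0 : (0 : ℝ) ≤ k := Nat.cast_nonneg k
  have hx : x ∈ Δ := hΔ ⟨0, Nat.zero_le _, by rw [h0, wdist_self]; push_cast; linarith⟩
  have hvΔ : v ∈ Δ := hΔ ⟨i0, hi0, by linarith⟩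
  refine hconv Δ x y v hx hvΔ ?_
  have hA := hmain (wdist S x y) α hα Δ (fun i hi w hw => hin i hi w (by
    have : (wl S w : ℝ) ≤ r := by exact_mod_cast hw
    linarith)) i0 hi0
  rw [h0, hL] at hA
  set b := (α i0)⁻¹ * v with hbdef
  have hbl : wl S b ≤ ⌊R1⌋₊ := by
    rw [wdist_comm hS] at hvf; exact hvf
  have hH := hb b Δ (α i0) (fun w hw => hin i0 hi0 w (by
    have h1 : (wl S w : ℝ) ≤ ⌊R1⌋₊ := by exact_mod_cast hw.trans hbl
    have := Nat.floor_le hR1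
    linarith))
  rw [hbdef, mul_inv_cancel_left, ← hbdef] at hH
  have hp : K ^ wl S b ≤ K ^ ⌊R1⌋₊ := pow_le_pow_right' hK1 hbl
  have h1 := (Hk_mono hH.1 hp).1 x
  have h2 := (Hk_mono hH.2 hp).2 y
  calc _ ≤ C * (gE μ Δ x (α i0) * gE μ Δ (α i0) y) := hA
    _ ≤ C * ((K ^ ⌊R1⌋₊ * gE μ Δ x v) * (K ^ ⌊R1⌋₊ * gE μ Δ v y)) := by gcongr
    _ = _ := by ring

theorem green_multiplicativity_near_geodesic
    (Γ : Type) [Group Γ] (S : Set Γ) (δ : ℝ)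
    (hS : IsGenSet S) (hδ : IsHyperbolic S δ) (hne : Nonelementary Γ)
    (μ : Γ → ℝ) (hμ : IsRWMeasure S μ) :
    ∃ R0 : ℝ, 0 < R0 ∧ ∃ C : ℝ, 1 ≤ C ∧
      (∀ (x y v : Γ) (α : ℕ → Γ) (Δ : Set Γ), IsGeodesicSeg S x y α →
        (∃ i ≤ wdist S x y, α i = v) → segN S x y α R0 ⊆ Δ →
        greenR μ Δ x y ≤ C * greenFR μ Δ x v * greenR μ Δ v y) ∧
      ∀ R1 : ℝ, 0 < R1 → ∃ C' : ℝ, 1 ≤ C' ∧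
        ∀ (x y v : Γ) (α : ℕ → Γ) (Δ : Set Γ), IsGeodesicSeg S x y α →
          v ∈ segN S x y α R1 → segN S x y α (R0 + R1) ⊆ Δ →
          greenR μ Δ x y ≤ C' * greenFR μ Δ x v * greenR μ Δ v y := by
  obtain ⟨R0, hR0, h⟩ := main_aux hS hδ hne hμ
  obtain ⟨C, hC, h0⟩ := h 0 le_rfl
  refine ⟨R0, hR0, C, hC, ?_, fun R1 hR1 => h R1 hR1.le⟩
  rintro x y v α Δ hα ⟨i, hi, rfl⟩ hΔ
  exact h0 x y (α i) α Δ hα ⟨i, hi, by simp [wdist_self]⟩ (by simpa using hΔ)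

end HarmonicBoundary
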